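/- arXiv:0711.4197 — 2 statements merged into one kernel-verified Lean document; each statement's English description precedes it below -/
import Mathlib

section
/- Let c₀ > 0, c > 0, and let M ∈ C_c^∞(ℝ²) satisfy the flag-F₁ seminorm bounds with constants 𝒞. Set K(x,y) = M(x, y − c₀x²) and let m(ξ,η) = ∫∫_{ℝ²} e^{−2πi(xξ + yη)} K(x,y) dx dy be its Fourier transform. Then on the region {(ξ,η) : |η| > c|ξ|² > 0}, m satisfies the Mikhlin multiplier estimates for the nonisotropic dilations (ξ,η) ↦ (λξ, λ²η): for all α, β ∈ ℕ, |∂_ξ^α ∂_η^β m(ξ,η)| ≤ C_{α,β}(|ξ| + |η|^{1/2})^{−α−2β}, with constants C_{α,β} depending only on α, β, c, c₀ and 𝒞 (in particular not on the support of M). -/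
open Real Filter Topology MeasureTheory ENNReal NNReal

noncomputable section

/-- `eI r = exp(i r)`. -/
def eI (r : ℝ) : ℂ := Complex.exp (Complex.I * r)

/-- A normalized bump function on `ℝ`: a `C^∞` function supported in `[-1,1]`
with `|φ| ≤ 1` and `|φ'| ≤ 1`. -/
def IsNormalizedBump (φ : ℝ → ℝ) : Prop :=
  ContDiff ℝ (⊤ : ℕ∞) φ ∧ (∀ t : ℝ, 1 < |t| → φ t = 0) ∧
  (∀ t, |φ t| ≤ 1) ∧ (∀ t, |deriv φ t| ≤ 1)

/-- A compactly supported smooth function `M` on `ℝ²` satisfies the flag-`F₁` seminorm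
bounds with constants `𝒞 = (Cab, C1, C2)` if:
(i) `|∂_x^α ∂_y^β M(x,y)| ≤ Cab α β (|x|+|y|^{1/2})^{-1-α} |y|^{-1-β}` for `y ≠ 0`;
(ii) for every normalized bump `φ` and `R > 0`, the functions
`y ↦ ∫ M(x,y) φ(Rx) dx` and `x ↦ ∫ M(x,y) φ(Ry) dy` are CZ kernels on `ℝ`
with constants `(C1, C2)` (decay and cancellation), uniformly in `φ` and `R`. -/
def FlagF1FunBounds (Cab : ℕ → ℕ → ℝ) (C1 : ℕ → ℝ) (C2 : ℝ) (M : ℝ → ℝ → ℂ) : Prop :=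
  ContDiff ℝ (⊤ : ℕ∞) (fun p : ℝ × ℝ => M p.1 p.2) ∧
  HasCompactSupport (fun p : ℝ × ℝ => M p.1 p.2) ∧
  (∀ (α β : ℕ) (x y : ℝ), y ≠ 0 →
    ‖iteratedDeriv α (fun x' : ℝ => iteratedDeriv β (fun y' : ℝ => M x' y') y) x‖
      ≤ Cab α β * (|x| + |y| ^ ((1:ℝ)/2)) ^ (-1 - (α : ℝ)) * |y| ^ (-1 - (β : ℝ))) ∧
  (∀ φ : ℝ → ℝ, IsNormalizedBump φ → ∀ R : ℝ, 0 < R →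
    (∀ (α : ℕ) (y : ℝ), y ≠ 0 →
      ‖iteratedDeriv α (fun y' : ℝ => ∫ x : ℝ, M x y' * (φ (R * x) : ℂ)) y‖
        ≤ C1 α * |y| ^ (-1 - (α : ℝ))) ∧
    (∀ δ : ℝ, 0 < δ → ∀ ψ : ℝ → ℝ, IsNormalizedBump ψ →
      ‖∫ y : ℝ, (∫ x : ℝ, M x y * (φ (R * x) : ℂ)) * (ψ (δ * y) : ℂ)‖ ≤ C2) ∧
    (∀ (α : ℕ) (x : ℝ), x ≠ 0 →
      ‖iteratedDeriv α (fun x' : ℝ => ∫ y : ℝ, M x' y * (φ (R * y) : ℂ)) x‖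
        ≤ C1 α * |x| ^ (-1 - (α : ℝ))) ∧
    (∀ δ : ℝ, 0 < δ → ∀ ψ : ℝ → ℝ, IsNormalizedBump ψ →
      ‖∫ x : ℝ, (∫ y : ℝ, M x y * (φ (R * y) : ℂ)) * (ψ (δ * x) : ℂ)‖ ≤ C2))

section ParametricIntegral

variable {E : Type*} [NormedAddCommGroup E] [MeasureSpace E] [BorelSpace E]
  [IsFiniteMeasureOnCompacts (volume : Measure E)]

/-- Differentiation under the integral sign for a jointly continuous integrand supported in a fixed
compact set. -/
theorem hasDerivAt_integral_of_support_compact {F F' : ℝ → E → ℂ} {K : Set E} (hK : IsCompact K)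
    (hF : Continuous fun q : ℝ × E => F q.1 q.2) (hF' : Continuous fun q : ℝ × E => F' q.1 q.2)
    (hsF : ∀ t, ∀ p ∉ K, F t p = 0) (hsF' : ∀ t, ∀ p ∉ K, F' t p = 0)
    (hd : ∀ t p, HasDerivAt (fun s => F s p) (F' t p) t) (t₀ : ℝ) :
    HasDerivAt (fun t => ∫ p, F t p) (∫ p, F' t₀ p) t₀ := by
  have hmeas : ∀ t, AEStronglyMeasurable (F t) (volume : Measure E) := fun t =>
    (hF.comp (by fun_prop : Continuous fun p : E => (t, p))).aestronglyMeasurable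
  obtain ⟨C, hC⟩ := ((isCompact_closedBall t₀ 1).prod hK).exists_bound_of_continuousOn
    hF'.continuousOn
  refine (hasDerivAt_integral_of_dominated_loc_of_deriv_le (s := Metric.closedBall t₀ 1)
    (bound := K.indicator fun _ => C) (Metric.closedBall_mem_nhds t₀ one_pos)
    (Eventually.of_forall hmeas) ?_
    (hF'.comp (by fun_prop : Continuous fun p : E => (t₀, p))).aestronglyMeasurable
    (Eventually.of_forall fun p t ht => ?_) ?_ (Eventually.of_forall fun p t _ => hd t p)).2
  · exact (hF.comp (by fun_prop : Continuous fun p : E => (t₀, p))).integrable_of_hasCompactSupport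
      (HasCompactSupport.intro hK (hsF t₀))
  · by_cases hp : p ∈ K
    · rw [Set.indicator_of_mem hp]
      exact hC (t, p) ⟨ht, hp⟩
    · rw [hsF' t p hp, Set.indicator_of_notMem hp, norm_zero]
  · exact (integrable_indicator_iff hK.measurableSet).2
      (integrableOn_const hK.measure_lt_top.ne)

end ParametricIntegral

/-- `F` is a smooth function of two real variables with compact support. -/
def IsTestFun (F : ℝ → ℝ → ℂ) : Prop :=
  ContDiff ℝ (⊤ : ℕ∞) (fun p : ℝ × ℝ => F p.1 p.2) ∧
    HasCompactSupport (fun p : ℝ × ℝ => F p.1 p.2)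

namespace IsTestFun

variable {F : ℝ → ℝ → ℂ}

theorem swap (hF : IsTestFun F) : IsTestFun fun x y => F y x :=
  ⟨hF.1.comp (contDiff_snd.prodMk contDiff_fst),
    hF.2.comp_homeomorph (Homeomorph.prodComm ℝ ℝ)⟩

theorem mul {w : ℝ × ℝ → ℂ} (hF : IsTestFun F) (hw : ContDiff ℝ (⊤ : ℕ∞) w) :
    IsTestFun fun x y => F x y * w (x, y) :=
  ⟨hF.1.mul hw, hF.2.mul_right⟩

theorem contDiff_right (hF : IsTestFun F) (x : ℝ) : ContDiff ℝ (⊤ : ℕ∞) (F x) :=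
  hF.1.comp (contDiff_const.prodMk contDiff_id)

theorem exists_compact (hF : IsTestFun F) :
    ∃ K : Set ℝ, IsCompact K ∧ ∀ x, ∀ y ∉ K, F x y = 0 := by
  refine ⟨Prod.snd '' tsupport (fun p : ℝ × ℝ => F p.1 p.2), hF.2.isCompact.image continuous_snd,
    fun x y hy => ?_⟩
  by_contra h
  exact hy ⟨(x, y), subset_tsupport _ h, rfl⟩

theorem hasCompactSupport_right (hF : IsTestFun F) (x : ℝ) : HasCompactSupport (F x) := by
  obtain ⟨K, hK, h⟩ := hF.exists_compact
  exact HasCompactSupport.intro hK (h x)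

theorem deriv_right_eq (hF : IsTestFun F) (x y : ℝ) :
    deriv (F x) y = fderiv ℝ (fun p : ℝ × ℝ => F p.1 p.2) (x, y) (0, 1) := by
  have h1 : HasFDerivAt (fun p : ℝ × ℝ => F p.1 p.2) _ (x, y) :=
    (hF.1.differentiable (by simp) (x, y)).hasFDerivAt
  exact (h1.comp_hasDerivAt y ((hasDerivAt_const y x).prodMk (hasDerivAt_id y))).deriv

theorem deriv_right (hF : IsTestFun F) : IsTestFun fun x y => deriv (F x) y := by
  have h : (fun p : ℝ × ℝ => deriv (F p.1) p.2) =
      fun p => fderiv ℝ (fun p : ℝ × ℝ => F p.1 p.2) p (0, 1) :=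
    funext fun p => hF.deriv_right_eq p.1 p.2
  unfold IsTestFun
  rw [h]
  exact ⟨(hF.1.fderiv_right (m := (⊤ : ℕ∞)) (by simp)).clm_apply contDiff_const,
    hF.2.fderiv_apply ℝ _⟩

theorem iteratedDeriv_right (hF : IsTestFun F) (n : ℕ) :
    IsTestFun fun x y => iteratedDeriv n (F x) y := by
  induction n with
  | zero => simpa using hF
  | succ n ih => simpa only [iteratedDeriv_succ] using ih.deriv_right

theorem iteratedDeriv_left (hF : IsTestFun F) (n : ℕ) :
    IsTestFun fun x y => iteratedDeriv n (fun x' => F x' y) x :=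
  (hF.swap.iteratedDeriv_right n).swap

theorem integrable_right (hF : IsTestFun F) (x : ℝ) : Integrable (F x) :=
  (hF.contDiff_right x).continuous.integrable_of_hasCompactSupport (hF.hasCompactSupport_right x)

theorem hasDerivAt_integral (hF : IsTestFun F) (x : ℝ) :
    HasDerivAt (fun x => ∫ y, F x y) (∫ y, deriv (fun x' => F x' y) x) x := by
  have hF' := hF.swap.deriv_right.swap
  obtain ⟨K, hK, h⟩ := hF.exists_compact
  refine hasDerivAt_integral_of_support_compact (F := F)
    (F' := fun x y => deriv (fun x' => F x' y) x) hK hF.1.continuous hF'.1.continuous h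
    (fun x y hy => ?_) (fun x y => ?_) x
  · simp [h _ y hy]
  · exact ((hF.swap.contDiff_right y).differentiable (by simp) x).hasDerivAt

theorem iteratedDeriv_integral (hF : IsTestFun F) (n : ℕ) :
    iteratedDeriv n (fun x => ∫ y, F x y) =
      fun x => ∫ y, iteratedDeriv n (fun x' => F x' y) x := by
  induction n with
  | zero => simp
  | succ n ih =>
    rw [iteratedDeriv_succ, ih]
    funext x
    rw [(hF.iteratedDeriv_left n).hasDerivAt_integral x |>.deriv]
    simp only [iteratedDeriv_succ]

theorem contDiff_integral (hF : IsTestFun F) :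
    ContDiff ℝ (⊤ : ℕ∞) (fun x => ∫ y, F x y) := by
  refine contDiff_of_differentiable_iteratedDeriv fun n _ => ?_
  rw [hF.iteratedDeriv_integral n]
  exact fun x => ((hF.iteratedDeriv_left n).hasDerivAt_integral x).differentiableAt

theorem hasCompactSupport_integral (hF : IsTestFun F) :
    HasCompactSupport (fun x => ∫ y, F x y) := by
  obtain ⟨K, hK, h⟩ := hF.swap.exists_compact
  exact HasCompactSupport.intro hK fun x hx => by simp [h _ x hx]

end IsTestFun

/-- `g` is a symbol of order `s` on the line, with seminorm bounds `C`. -/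
def IsSymbol (s : ℤ) (C : ℕ → ℝ) (g : ℝ → ℂ) : Prop :=
  ContDiff ℝ (⊤ : ℕ∞) g ∧ ∀ (a : ℕ) (x : ℝ), ‖iteratedDeriv a g x‖ ≤ C a * (1 + |x|) ^ (s - a)

/-- The seminorm bounds of a product of symbols. -/
def leibnizBound (C D : ℕ → ℝ) (a : ℕ) : ℝ :=
  ∑ i ∈ Finset.range (a + 1), (a.choose i) * C i * D (a - i)

theorem norm_iteratedDeriv_mul_le {s t : ℤ} {C D : ℕ → ℝ} {f g : ℝ → ℂ} {x : ℝ}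
    (hf : ContDiff ℝ (⊤ : ℕ∞) f) (hg : ContDiff ℝ (⊤ : ℕ∞) g)
    (hfx : ∀ i : ℕ, ‖iteratedDeriv i f x‖ ≤ C i * (1 + |x|) ^ (s - i))
    (hgx : ∀ i : ℕ, ‖iteratedDeriv i g x‖ ≤ D i * (1 + |x|) ^ (t - i)) (a : ℕ) :
    ‖iteratedDeriv a (fun x => f x * g x) x‖ ≤ leibnizBound C D a * (1 + |x|) ^ (s + t - a) := by
  rw [iteratedDeriv_fun_mul (hf.contDiffAt.of_le (by exact_mod_cast le_top))
    (hg.contDiffAt.of_le (by exact_mod_cast le_top)), leibnizBound, Finset.sum_mul]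
  refine norm_sum_le_of_le _ fun i hi => ?_
  have hia : i ≤ a := Nat.lt_succ_iff.1 (Finset.mem_range.1 hi)
  have h0 : (1 + |x|) ≠ 0 := by positivity
  have hpow : (1 + |x|) ^ (s + t - a) = (1 + |x|) ^ (s - i) * (1 + |x|) ^ (t - (a - i : ℕ)) := by
    rw [← zpow_add₀ h0]; congr 1; push_cast [hia]; ring
  rw [hpow, norm_mul, norm_mul, Complex.norm_natCast]
  calc (a.choose i : ℝ) * ‖iteratedDeriv i f x‖ * ‖iteratedDeriv (a - i) g x‖
      ≤ (a.choose i : ℝ) * (C i * (1 + |x|) ^ (s - i)) *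
          (D (a - i) * (1 + |x|) ^ (t - (a - i : ℕ))) :=
        mul_le_mul (mul_le_mul_of_nonneg_left (hfx i) (Nat.cast_nonneg _)) (hgx _)
          (norm_nonneg _) (mul_nonneg (Nat.cast_nonneg _) ((norm_nonneg _).trans (hfx i)))
    _ = _ := by ring

namespace IsSymbol

variable {s t : ℤ} {C D : ℕ → ℝ} {f g : ℝ → ℂ}

theorem nonneg (hf : IsSymbol s C f) (a : ℕ) : 0 ≤ C a := by
  have := (norm_nonneg _).trans (hf.2 a 0)
  simpa using this

theorem mul (hf : IsSymbol s C f) (hg : IsSymbol t D g) :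
    IsSymbol (s + t) (leibnizBound C D) (fun x => f x * g x) :=
  ⟨hf.1.mul hg.1, fun a x =>
    norm_iteratedDeriv_mul_le hf.1 hg.1 (fun i => hf.2 i x) (fun i => hg.2 i x) a⟩

theorem add (hf : IsSymbol s C f) (hg : IsSymbol s D g) :
    IsSymbol s (C + D) (fun x => f x + g x) := by
  refine ⟨hf.1.add hg.1, fun a x => ?_⟩
  rw [iteratedDeriv_fun_add (hf.1.contDiffAt.of_le (by exact_mod_cast le_top))
    (hg.1.contDiffAt.of_le (by exact_mod_cast le_top)), Pi.add_apply, add_mul]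
  exact norm_add_le_of_le (hf.2 a x) (hg.2 a x)

theorem const_mul (hf : IsSymbol s C f) (z : ℂ) :
    IsSymbol s (fun a => ‖z‖ * C a) (fun x => z * f x) := by
  refine ⟨contDiff_const.mul hf.1, fun a x => ?_⟩
  rw [iteratedDeriv_const_mul_field, norm_mul, mul_assoc]
  exact mul_le_mul_of_nonneg_left (hf.2 a x) (norm_nonneg z)

theorem deriv (hf : IsSymbol s C f) :
    IsSymbol (s - 1) (fun a => C (a + 1)) (deriv f) := by
  refine ⟨(contDiff_infty_iff_deriv.1 hf.1).2, fun a x => ?_⟩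
  rw [← iteratedDeriv_succ']
  convert hf.2 (a + 1) x using 3
  push_cast; ring

theorem mono_order (hf : IsSymbol s C f) (hst : s ≤ t) : IsSymbol t C f := by
  refine ⟨hf.1, fun a x => (hf.2 a x).trans ?_⟩
  have := hf.nonneg a
  have : 1 ≤ 1 + |x| := by simp
  gcongr

/-- The seminorm bounds of a linear function with coefficients at most `B`. -/
def linearBound (B : ℝ) (a : ℕ) : ℝ := if a ≤ 1 then B else 0

theorem linear {b m B : ℝ} (hb : |b| ≤ B) (hm : |m| ≤ B) :
    IsSymbol 1 (linearBound B) (fun x => ((b + m * x : ℝ) : ℂ)) := by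
  have hd : _root_.deriv (fun x : ℝ => ((b + m * x : ℝ) : ℂ)) = fun _ => (m : ℂ) := by
    funext x
    have h : HasDerivAt (fun x : ℝ => b + m * x) m x := by
      simpa using ((hasDerivAt_id x).const_mul m).const_add b
    exact h.ofReal_comp.deriv
  refine ⟨Complex.ofRealCLM.contDiff.comp
    (contDiff_const.add (contDiff_const.mul contDiff_id)), fun a x => ?_⟩
  have hB : 0 ≤ B := (abs_nonneg b).trans hb
  rcases a with _ | _ | a
  · simp only [iteratedDeriv_zero, linearBound, Complex.norm_real, norm_eq_abs]
    simp only [zero_le, if_true, Nat.cast_zero, sub_zero, zpow_one]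
    calc |b + m * x| ≤ |b| + |m| * |x| := by rw [← abs_mul]; exact abs_add_le _ _
      _ ≤ B + B * |x| := by gcongr
      _ = _ := by ring
  · rw [iteratedDeriv_succ', hd]
    simp [linearBound, hm]
  · simp only [iteratedDeriv_succ', hd, deriv_const']
    simp [linearBound, iteratedDeriv_fun_const_zero]

theorem one : IsSymbol 0 (fun a => if a = 0 then 1 else 0) (fun _ => (1 : ℂ)) := by
  refine ⟨contDiff_const, fun a x => ?_⟩
  rcases a with _ | a <;> simp [iteratedDeriv_const]

theorem pow (j : ℕ) : ∃ C, IsSymbol j C (fun x => (x : ℂ) ^ j) := by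
  induction j with
  | zero => exact ⟨_, by simpa using one⟩
  | succ j ih =>
    obtain ⟨C, hC⟩ := ih
    have h := linear (b := 0) (m := 1) (B := 1) (by simp) (by simp)
    refine ⟨_, by simpa [pow_succ] using hC.mul h⟩

theorem of_hasCompactSupport (hf : ContDiff ℝ (⊤ : ℕ∞) f) (hc : HasCompactSupport f) (s : ℤ) :
    ∃ C, IsSymbol s C f := by
  have key : ∀ a : ℕ, ∃ C, ∀ x, ‖iteratedDeriv a f x‖ ≤ C * (1 + |x|) ^ (s - a) := by
    intro a
    have hsupp : HasCompactSupport (iteratedDeriv a f) := by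
      induction a with
      | zero => simpa using hc
      | succ a ih => rw [iteratedDeriv_succ]; exact ih.deriv
    have hcont : Continuous fun x : ℝ => (((1 + |x|) ^ (-(s - a)) : ℝ) : ℂ) * iteratedDeriv a f x :=
      (Complex.continuous_ofReal.comp ((by fun_prop : Continuous fun x : ℝ => 1 + |x|).zpow₀ _
        fun x => Or.inl (by positivity))).mul
        (hf.continuous_iteratedDeriv a (by exact_mod_cast le_top))
    obtain ⟨C, hC⟩ := hcont.bounded_above_of_compact_support hsupp.mul_left
    refine ⟨C, fun x => ?_⟩
    have h := hC x
    have hpos : 0 < (1 + |x|) ^ (s - a) := by positivity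
    rw [norm_mul, Complex.norm_real, norm_of_nonneg (by positivity), zpow_neg,
      inv_mul_le_iff₀ hpos] at h
    linarith
  choose C hC using key
  exact ⟨C, hf, hC⟩

end IsSymbol

theorem iteratedDeriv_inv_linear (b m : ℝ) (z : ℂ) (hz : ∀ x : ℝ, ((b + m * x : ℝ) : ℂ) + z ≠ 0)
    (n : ℕ) : iteratedDeriv n (fun x : ℝ => (((b + m * x : ℝ) : ℂ) + z)⁻¹) =
      fun x => (-1) ^ n * n.factorial * (m : ℂ) ^ n *
        ((((b + m * x : ℝ) : ℂ) + z)⁻¹) ^ (n + 1) := by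
  induction n with
  | zero => simp
  | succ n ih =>
    rw [iteratedDeriv_succ, ih]
    funext x
    have h : HasDerivAt (fun x : ℝ => b + m * x) m x := by
      simpa using ((hasDerivAt_id x).const_mul m).const_add b
    have h2 := (((h.ofReal_comp.add_const z).inv (hz x)).pow (n + 1)).const_mul
      ((-1) ^ n * n.factorial * (m : ℂ) ^ n)
    refine h2.deriv.trans ?_
    simp only [Nat.add_sub_cancel, Nat.factorial_succ, Pi.inv_apply]
    generalize ((b + m * x : ℝ) : ℂ) + z = w
    push_cast
    field_simp
    ring

theorem IsSymbol.inv_linear {b m B Λ : ℝ} (hΛ : 0 < Λ) (hb : |b| ≤ B) (hm : |m| = Λ) {z : ℂ}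
    (hz : z = Complex.I ∨ z = -Complex.I) :
    IsSymbol (-1) (fun a => a.factorial * Λ ^ a * (1 + (1 + B) / Λ) ^ (a + 1))
      (fun x => (((b + m * x : ℝ) : ℂ) + z)⁻¹) := by
  have hB : 0 ≤ B := (abs_nonneg b).trans hb
  have him : |z.im| = 1 := by rcases hz with rfl | rfl <;> simp
  have hre : z.re = 0 := by rcases hz with rfl | rfl <;> simp
  have hone : ∀ x : ℝ, 1 ≤ ‖((b + m * x : ℝ) : ℂ) + z‖ := fun x => by
    have := Complex.abs_im_le_norm (((b + m * x : ℝ) : ℂ) + z)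
    rwa [Complex.add_im, Complex.ofReal_im, zero_add, him] at this
  have hne : ∀ x : ℝ, ((b + m * x : ℝ) : ℂ) + z ≠ 0 := fun x h => by
    have := hone x
    rw [h, norm_zero] at this
    linarith
  have hlow : ∀ x : ℝ, 1 + |x| ≤ (1 + (1 + B) / Λ) * ‖((b + m * x : ℝ) : ℂ) + z‖ := fun x => by
    have h1 := Complex.abs_re_le_norm (((b + m * x : ℝ) : ℂ) + z)
    rw [Complex.add_re, Complex.ofReal_re, hre, add_zero] at h1
    have h2 : Λ * |x| ≤ |b + m * x| + B := by
      rw [← hm, ← abs_mul]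
      calc |m * x| = |(b + m * x) - b| := by ring_nf
        _ ≤ _ := (abs_sub _ _).trans (by linarith)
    have h3 := hone x
    set N := ‖((b + m * x : ℝ) : ℂ) + z‖
    have h4 : |x| ≤ (1 + B) / Λ * N := by
      rw [div_mul_eq_mul_div, le_div_iff₀ hΛ]
      nlinarith
    linarith
  refine ⟨?_, fun a x => ?_⟩
  · refine ContDiff.inv ?_ hne
    exact (Complex.ofRealCLM.contDiff.comp
    (contDiff_const.add (contDiff_const.mul contDiff_id))).add contDiff_const
  · rw [iteratedDeriv_inv_linear b m z hne]
    simp only [norm_mul, norm_pow, norm_neg, norm_one, one_pow, one_mul, norm_inv,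
      Complex.norm_natCast, Complex.norm_real, norm_eq_abs, hm]
    rw [mul_assoc (_ * _)]
    gcongr
    have hpos : 0 < 1 + |x| := by positivity
    have hN : 0 < ‖((b + m * x : ℝ) : ℂ) + z‖ := by linarith [hone x]
    rw [show ((-1 : ℤ) - a) = -((a + 1 : ℕ) : ℤ) by push_cast; ring, zpow_neg, zpow_natCast,
      ← inv_pow, ← mul_pow]
    gcongr
    rw [← div_eq_mul_inv, le_div_iff₀ hpos, inv_mul_le_iff₀ hN, mul_comm]
    exact hlow x

theorem norm_eI (r : ℝ) : ‖eI r‖ = 1 := by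
  rw [eI, mul_comm, Complex.norm_exp_ofReal_mul_I]

theorem eI_add (r s : ℝ) : eI (r + s) = eI r * eI s := by
  rw [eI, eI, eI, ← Complex.exp_add]
  push_cast
  ring_nf

theorem contDiff_eI : ContDiff ℝ (⊤ : ℕ∞) eI :=
  (contDiff_const.mul Complex.ofRealCLM.contDiff).cexp

theorem HasDerivAt.eI {p : ℝ → ℝ} {p' x : ℝ} (hp : HasDerivAt p p' x) :
    HasDerivAt (fun x => eI (p x)) (Complex.I * p' * eI (p x)) x := by
  have := (hp.ofReal_comp.const_mul Complex.I).cexp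
  rwa [mul_comm] at this

/-- The quadratic oscillation `exp(-2πi(bx + μx²))`. -/
def chirp (b μ x : ℝ) : ℂ := eI (-2 * π * (x * b + μ * x ^ 2))

theorem norm_chirp (b μ x : ℝ) : ‖chirp b μ x‖ = 1 := norm_eI _

theorem contDiff_chirp (b μ : ℝ) : ContDiff ℝ (⊤ : ℕ∞) (chirp b μ) :=
  contDiff_eI.comp (by fun_prop)

theorem hasDerivAt_chirp (b μ x : ℝ) : HasDerivAt (chirp b μ)
    (-(2 * π * Complex.I) * ((b + 2 * μ * x : ℝ) : ℂ) * chirp b μ x) x := by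
  have h : HasDerivAt (fun x : ℝ => -2 * π * (x * b + μ * x ^ 2))
      (-2 * π * (b + μ * (2 * x))) x := by
    have h1 := ((hasDerivAt_id x).mul_const b).add ((hasDerivAt_pow 2 x).const_mul μ)
    simpa using h1.const_mul (-2 * π)
  refine h.eI.congr_deriv ?_
  rw [chirp]
  push_cast
  ring

theorem integrable_one_add_abs_zpow : Integrable fun x : ℝ => (1 + |x|) ^ (-2 : ℤ) := by
  have h := integrable_one_add_norm (E := ℝ) (μ := volume) (r := 2) (by simp)
  refine h.congr (Eventually.of_forall fun x => ?_)
  simp only [norm_eq_abs]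
  rw [← Real.rpow_intCast]
  norm_num

/-- One integration by parts against a chirp, gaining two orders of decay. -/
theorem integral_mul_chirp {g : ℝ → ℂ} (hc : HasCompactSupport g)
    (b μ : ℝ) {h : ℝ → ℂ} (hh : ContDiff ℝ (⊤ : ℕ∞) h)
    (hgh : ∀ x, h x * (1 + ((b + 2 * μ * x : ℝ) : ℂ) ^ 2) = g x) :
    ∫ x, g x * chirp b μ x =
      ∫ x, (h x + (-(Complex.I / (2 * π))) *
        deriv (fun x => ((b + 2 * μ * x : ℝ) : ℂ) * h x) x) * chirp b μ x := by
  have hch : HasCompactSupport h := by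
    refine hc.mono fun x hx => ?_
    rw [Function.mem_support, ← hgh x]
    refine mul_ne_zero hx ?_
    norm_cast
    positivity
  have hl : ContDiff ℝ (⊤ : ℕ∞) (fun x : ℝ => ((b + 2 * μ * x : ℝ) : ℂ) * h x) :=
    (Complex.ofRealCLM.contDiff.comp
      (contDiff_const.add (contDiff_const.mul contDiff_id))).mul hh
  have hcl : HasCompactSupport (fun x : ℝ => ((b + 2 * μ * x : ℝ) : ℂ) * h x) := hch.mul_left
  have hdl := (contDiff_infty_iff_deriv.1 hl).2
  have hint : ∀ u v : ℝ → ℂ, HasCompactSupport u → Continuous u → Continuous v →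
      Integrable (fun x => u x * v x) := fun u v h1 h2 h3 =>
    (h2.mul h3).integrable_of_hasCompactSupport h1.mul_right
  have hce := (contDiff_chirp b μ).continuous
  have hlc : Continuous fun x : ℝ =>
      -(2 * π * Complex.I) * ((b + 2 * μ * x : ℝ) : ℂ) * chirp b μ x :=
    (continuous_const.mul (Complex.continuous_ofReal.comp (by fun_prop))).mul hce
  have hparts := integral_mul_deriv_eq_deriv_mul_of_integrable
    (u := fun x : ℝ => ((b + 2 * μ * x : ℝ) : ℂ) * h x) (v := chirp b μ)
    (fun x _ => (hl.differentiable (by simp) x).hasDerivAt) (fun x _ => hasDerivAt_chirp b μ x)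
    (hint _ _ hcl hl.continuous hlc) (hint _ _ hcl.deriv hdl.continuous hce)
    (hint _ _ hcl hl.continuous hce)
  have hpi : (π : ℂ) ≠ 0 := by exact_mod_cast Real.pi_ne_zero
  have hsplit : ∀ x : ℝ, g x * chirp b μ x = h x * chirp b μ x + Complex.I / (2 * π) *
      (((b + 2 * μ * x : ℝ) : ℂ) * h x *
        (-(2 * π * Complex.I) * ((b + 2 * μ * x : ℝ) : ℂ) * chirp b μ x)) := fun x => by
    rw [← hgh x]
    generalize ((b + 2 * μ * x : ℝ) : ℂ) = w
    field_simp
    rw [Complex.I_sq]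
    ring
  simp only [hsplit, add_mul, mul_assoc (-(Complex.I / (2 * π)))]
  rw [integral_add (hint _ _ hch hh.continuous hce)
      ((hint _ _ hcl hl.continuous hlc).const_mul _),
    integral_add (hint _ _ hch hh.continuous hce)
      ((hint _ _ hcl.deriv hdl.continuous hce).const_mul _),
    integral_const_mul, integral_const_mul, hparts]
  ring

theorem exists_bound_integral_symbol_mul_chirp {B m : ℝ} (hm : 0 < m) (s : ℤ) (C : ℕ → ℝ) :
    ∃ D, ∀ (b μ : ℝ) (g : ℝ → ℂ), |b| ≤ B → |μ| = m → IsSymbol s C g → HasCompactSupport g →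
      ‖∫ x, g x * chirp b μ x‖ ≤ D := by
  obtain ⟨n, hn⟩ : ∃ n : ℕ, s ≤ 2 * n - 2 :=
    ⟨(s + 2).toNat, by have := Int.self_le_toNat (s + 2); omega⟩
  induction n generalizing s C with
  | zero =>
    refine ⟨∫ x : ℝ, C 0 * (1 + |x|) ^ (-2 : ℤ), fun b μ g _ _ hg _ => ?_⟩
    refine norm_integral_le_of_norm_le (integrable_one_add_abs_zpow.const_mul _)
      (Eventually.of_forall fun x => ?_)
    rw [norm_mul, norm_chirp, mul_one]
    simpa using (hg.mono_order (t := -2) (by simpa using hn)).2 0 x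
  | succ n ih =>
    set Q : ℕ → ℝ := fun a => a.factorial * (2 * m) ^ a * (1 + (1 + B) / (2 * m)) ^ (a + 1)
    set H := leibnizBound C (leibnizBound Q Q)
    set N := leibnizBound (IsSymbol.linearBound (max B (2 * m))) H
    obtain ⟨D, hD⟩ := ih (s - 2) (H + fun a => ‖-(Complex.I / (2 * π))‖ * N (a + 1))
      (by push_cast at hn; omega)
    refine ⟨D, fun b μ g hb hμ hg hc => ?_⟩
    have hμ' : |2 * μ| = 2 * m := by rw [abs_mul, hμ]; norm_num
    have hp := IsSymbol.inv_linear (m := 2 * μ) (by positivity) hb hμ' (Or.inl rfl)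
    have hq := IsSymbol.inv_linear (m := 2 * μ) (by positivity) hb hμ' (Or.inr rfl)
    have hl := IsSymbol.linear (b := b) (m := 2 * μ) (B := max B (2 * m))
      (hb.trans (le_max_left _ _)) (hμ'.le.trans (le_max_right _ _))
    have hh := hg.mul (hp.mul hq)
    have hN := (hl.mul hh).deriv.const_mul (-(Complex.I / (2 * π)))
    have hL := (hh.mono_order (t := s - 2) (by omega)).add (hN.mono_order (by omega))
    rw [integral_mul_chirp hc b μ hh.1 fun x => ?_]
    · refine hD b μ _ hb hμ hL ?_
      have hch := hc.mul_right (f' := fun x => (((b + 2 * μ * x : ℝ) : ℂ) + Complex.I)⁻¹ *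
        (((b + 2 * μ * x : ℝ) : ℂ) + -Complex.I)⁻¹)
      exact hch.add (hch.mul_left.deriv.mul_left)
    · have h1 : ((b + 2 * μ * x : ℝ) : ℂ) + Complex.I ≠ 0 := fun h => by
        simpa using congrArg Complex.im h
      have h2 : ((b + 2 * μ * x : ℝ) : ℂ) + -Complex.I ≠ 0 := fun h => by
        simpa using congrArg Complex.im h
      generalize ((b + 2 * μ * x : ℝ) : ℂ) = w at *
      field_simp
      linear_combination g x * Complex.I_sq

/-- A smooth cutoff equal to `1` on `[-1/2, 1/2]` and supported in `[-1, 1]`. -/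
def cutoff : ContDiffBump (0 : ℝ) := ⟨1 / 2, 1, by norm_num, by norm_num⟩

/-- The complex-valued version of `cutoff`. -/
def cutoffC (x : ℝ) : ℂ := ((cutoff x : ℝ) : ℂ)

theorem contDiff_cutoffC : ContDiff ℝ (⊤ : ℕ∞) cutoffC :=
  Complex.ofRealCLM.contDiff.comp cutoff.contDiff

theorem hasCompactSupport_cutoffC : HasCompactSupport cutoffC :=
  cutoff.hasCompactSupport.comp_left Complex.ofReal_zero

theorem cutoffC_eq_zero {x : ℝ} (hx : 1 < |x|) : cutoffC x = 0 := by
  have : cutoff x = 0 := cutoff.zero_of_le_dist (by simpa [cutoff] using hx.le)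
  simp [cutoffC, this]

theorem cutoffC_eq_one {x : ℝ} (hx : |x| ≤ 1 / 2) : cutoffC x = 1 := by
  have : cutoff x = 1 := cutoff.one_of_mem_closedBall (by simpa [cutoff] using hx)
  simp [cutoffC, this]

theorem iteratedDeriv_eq_zero_of_eqOn {g : ℝ → ℂ} {r : ℝ} (hg : ∀ x, |x| < r → g x = 0) {x : ℝ}
    (hx : |x| < r) (n : ℕ) : iteratedDeriv n g x = 0 := by
  have h : g =ᶠ[𝓝 x] fun _ => 0 :=
    ((continuous_abs.tendsto x).eventually_lt_const hx).mono hg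
  rw [h.iteratedDeriv_eq n]
  simp

theorem exists_isSymbol_outerWeight (k : ℕ) :
    ∃ C, IsSymbol k C (fun x => (1 - cutoffC x) * (x : ℂ) ^ k) := by
  obtain ⟨C, hC⟩ := IsSymbol.of_hasCompactSupport contDiff_cutoffC hasCompactSupport_cutoffC 0
  obtain ⟨D, hD⟩ := IsSymbol.pow k
  have h := (IsSymbol.one.add (hC.const_mul (-1))).mul hD
  exact ⟨_, by simpa [sub_eq_add_neg] using h⟩

theorem outerWeight_eq_zero (k : ℕ) {x : ℝ} (hx : |x| < 1 / 2) :
    (1 - cutoffC x) * (x : ℂ) ^ k = 0 := by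
  rw [cutoffC_eq_one hx.le, sub_self, zero_mul]

/-- A smooth complex function supported in `[-1,1]` whose value and derivative are bounded
by `D`. -/
def IsBumpWith (D : ℝ) (f : ℝ → ℂ) : Prop :=
  ContDiff ℝ (⊤ : ℕ∞) f ∧ (∀ t : ℝ, 1 < |t| → f t = 0) ∧ (∀ t, ‖f t‖ ≤ D) ∧ ∀ t, ‖deriv f t‖ ≤ D

theorem isNormalizedBump_clm {D : ℝ} (hD : 0 < D) {f : ℝ → ℂ} (hf : IsBumpWith D f)
    (L : ℂ →L[ℝ] ℝ) (hL : ∀ z, |L z| ≤ ‖z‖) : IsNormalizedBump (fun t => L (f t) / D) := by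
  obtain ⟨h1, h2, h3, h4⟩ := hf
  refine ⟨(L.contDiff.comp h1).div_const D, fun t ht => by simp [h2 t ht], fun t => ?_, fun t => ?_⟩
  · rw [abs_div, abs_of_pos hD, div_le_one hD]
    exact (hL _).trans (h3 t)
  · have hd : HasDerivAt (fun t => L (f t) / D) (L (deriv f t) / D) t :=
      (L.hasFDerivAt.comp_hasDerivAt t (h1.differentiable (by simp) t).hasDerivAt).div_const D
    rw [hd.deriv, abs_div, abs_of_pos hD, div_le_one hD]
    exact (hL _).trans (h4 t)

theorem IsBumpWith.exists_normalizedBump {D : ℝ} (hD : 0 < D) {f : ℝ → ℂ} (hf : IsBumpWith D f) :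
    ∃ φ ψ : ℝ → ℝ, IsNormalizedBump φ ∧ IsNormalizedBump ψ ∧
      ∀ t, f t = D * φ t + (D * Complex.I) * ψ t := by
  refine ⟨_, _, isNormalizedBump_clm hD hf Complex.reCLM Complex.abs_re_le_norm,
    isNormalizedBump_clm hD hf Complex.imCLM Complex.abs_im_le_norm, fun t => ?_⟩
  have : (D : ℂ) ≠ 0 := by exact_mod_cast hD.ne'
  simp only [Complex.reCLM_apply, Complex.imCLM_apply, Complex.ofReal_div]
  field_simp
  rw [mul_comm Complex.I]
  exact (Complex.re_add_im _).symm

theorem exists_isBumpWith_mul_chirp {f : ℝ → ℂ} (hf : ContDiff ℝ (⊤ : ℕ∞) f)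
    (hs : ∀ t : ℝ, 1 < |t| → f t = 0) (B m : ℝ) :
    ∃ D, 0 < D ∧ ∀ b μ : ℝ, |b| ≤ B → |μ| ≤ m → IsBumpWith D (fun t => f t * chirp b μ t) := by
  have hc : HasCompactSupport f := HasCompactSupport.intro (isCompact_Icc (a := (-1 : ℝ)) (b := 1))
    fun t ht => hs t (by by_contra h; exact ht (abs_le.1 (not_lt.1 h)))
  have hf' := (contDiff_infty_iff_deriv.1 hf).2
  obtain ⟨C₀, hC₀⟩ := hf.continuous.bounded_above_of_compact_support hc
  obtain ⟨C₁, hC₁⟩ := hf'.continuous.bounded_above_of_compact_support hc.deriv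
  have h0 : 0 ≤ C₀ := (norm_nonneg _).trans (hC₀ 0)
  have h1 : 0 ≤ C₁ := (norm_nonneg _).trans (hC₁ 0)
  refine ⟨1 + C₀ + C₁ + C₀ * (2 * π * |B + 2 * m|), by positivity, fun b μ hb hμ =>
    ⟨hf.mul (contDiff_chirp b μ), fun t ht => by simp [hs t ht], fun t => ?_, fun t => ?_⟩⟩
  · rw [norm_mul, norm_chirp, mul_one]
    have : 0 ≤ C₀ * (2 * π * |B + 2 * m|) := by positivity
    linarith [hC₀ t]
  · have hd := ((hf.differentiable (by simp) t).hasDerivAt).mul (hasDerivAt_chirp b μ t)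
    refine (congrArg norm hd.deriv).trans_le ?_
    have h2 : ‖f t * (-(2 * π * Complex.I) * ((b + 2 * μ * t : ℝ) : ℂ) * chirp b μ t)‖ ≤
        C₀ * (2 * π * |B + 2 * m|) := by
      rcases lt_or_ge 1 |t| with ht | ht
      · rw [hs t ht, zero_mul, norm_zero]; positivity
      · have h3 : |b + 2 * μ * t| ≤ |B + 2 * m| := by
          refine le_trans ?_ (le_abs_self _)
          calc |b + 2 * μ * t| ≤ |b| + 2 * |μ| * |t| := by
                refine (abs_add_le _ _).trans (by rw [abs_mul, abs_mul, abs_two])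
            _ ≤ B + 2 * m * 1 := by
                have : 0 ≤ m := (abs_nonneg μ).trans hμ
                gcongr
            _ = _ := by ring
        simp only [norm_mul, norm_neg, norm_chirp, Complex.norm_I, Complex.norm_real,
          Complex.norm_ofNat, norm_eq_abs, abs_of_pos Real.pi_pos, mul_one]
        gcongr
        exact hC₀ t
    have h4 : ‖deriv f t * chirp b μ t‖ ≤ C₁ := by
      rw [norm_mul, norm_chirp, mul_one]; exact hC₁ t
    linarith [norm_add_le_of_le h4 h2]

/-- The part of the flag-`F₁` seminorm bounds used for the multiplier estimate. -/
def FlagF1PartialBounds (Cab : ℕ → ℕ → ℝ) (C1 : ℕ → ℝ) (C2 : ℝ) (M : ℝ → ℝ → ℂ) : Prop :=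
  IsTestFun M ∧
  (∀ (α β : ℕ) (x y : ℝ), y ≠ 0 →
    ‖iteratedDeriv α (fun x' : ℝ => iteratedDeriv β (fun y' : ℝ => M x' y') y) x‖
      ≤ Cab α β * (|x| + |y| ^ ((1:ℝ)/2)) ^ (-1 - (α : ℝ)) * |y| ^ (-1 - (β : ℝ))) ∧
  (∀ φ : ℝ → ℝ, IsNormalizedBump φ → ∀ R : ℝ, 0 < R →
    (∀ (α : ℕ) (x : ℝ), x ≠ 0 →
      ‖iteratedDeriv α (fun x' : ℝ => ∫ y : ℝ, M x' y * (φ (R * y) : ℂ)) x‖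
        ≤ C1 α * |x| ^ (-1 - (α : ℝ))) ∧
    (∀ δ : ℝ, 0 < δ → ∀ ψ : ℝ → ℝ, IsNormalizedBump ψ →
      ‖∫ x : ℝ, (∫ y : ℝ, M x y * (φ (R * y) : ℂ)) * (ψ (δ * x) : ℂ)‖ ≤ C2))

theorem IsTestFun.mul_right {F : ℝ → ℝ → ℂ} (hF : IsTestFun F) {w : ℝ → ℂ}
    (hw : ContDiff ℝ (⊤ : ℕ∞) w) : IsTestFun fun x y => F x y * w y :=
  hF.mul (w := fun p => w p.2) (hw.comp contDiff_snd)

theorem IsNormalizedBump.contDiff_ofReal {φ : ℝ → ℝ} (hφ : IsNormalizedBump φ) :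
    ContDiff ℝ (⊤ : ℕ∞) (fun y => (φ y : ℂ)) :=
  Complex.ofRealCLM.contDiff.comp hφ.1

theorem rpow_le_of_one_add_abs_le {A u x : ℝ} (hA : 0 < A) (h : 1 + |x| ≤ A * u) (n : ℕ) :
    u ^ (-1 - (n : ℝ)) ≤ A ^ (1 + n) * (1 + |x|) ^ ((-1 : ℤ) - n) := by
  have h1 : 0 < 1 + |x| := by positivity
  have hu : 0 < u := pos_of_mul_pos_right (h1.trans_le h) hA.le
  rw [show (-1 - (n : ℝ)) = -((1 + n : ℕ) : ℝ) by push_cast; ring,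
    Real.rpow_neg hu.le, Real.rpow_natCast, show (-1 - (n : ℤ)) = -((1 + n : ℕ) : ℤ) by push_cast; ring, zpow_neg, zpow_natCast,
    ← div_eq_mul_inv, le_div_iff₀ (by positivity), inv_mul_le_iff₀ (by positivity), ← mul_pow,
    mul_comm u]
  gcongr

theorem one_add_abs_le_of_half_le {x : ℝ} (hx : 1 / 2 ≤ |x|) : 1 + |x| ≤ 3 * |x| := by linarith

theorem one_add_abs_le_of_half_le_snd (x : ℝ) {y : ℝ} (hy : 1 / 2 ≤ |y|) :
    1 + |x| ≤ 2 * (|x| + |y| ^ ((1 : ℝ) / 2)) := by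
  have h : 1 / 2 ≤ |y| ^ ((1 : ℝ) / 2) := by
    rw [← Real.sqrt_eq_rpow]
    exact Real.le_sqrt_of_sq_le (by linarith)
  linarith [abs_nonneg x]

theorem integral_mul_chirp_zero {f : ℝ → ℂ} (hf : ContDiff ℝ (⊤ : ℕ∞) f) (hc : HasCompactSupport f)
    {η : ℝ} (hη : η ≠ 0) (n : ℕ) :
    ∫ y, f y * chirp η 0 y =
      ((2 * π * Complex.I * η)⁻¹) ^ n * ∫ y, iteratedDeriv n f y * chirp η 0 y := by
  induction n generalizing f with
  | zero => simp
  | succ n ih =>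
    have hf' := (contDiff_infty_iff_deriv.1 hf).2
    have hce := (contDiff_chirp η 0).continuous
    have hparts := integral_mul_deriv_eq_deriv_mul_of_integrable (u := f) (v := chirp η 0)
      (v' := fun y => -(2 * π * Complex.I * η) * chirp η 0 y)
      (fun x _ => (hf.differentiable (by simp) x).hasDerivAt)
      (fun x _ => (hasDerivAt_chirp η 0 x).congr_deriv (by simp))
      ((hf.continuous.mul (continuous_const.mul hce)).integrable_of_hasCompactSupport hc.mul_right)
      ((hf'.continuous.mul hce).integrable_of_hasCompactSupport hc.deriv.mul_right)
      ((hf.continuous.mul hce).integrable_of_hasCompactSupport hc.mul_right)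
    have hne : (2 * π * Complex.I * η : ℂ) ≠ 0 := by
      have := Real.pi_ne_zero
      simp [hη, this]
    rw [iteratedDeriv_succ', pow_succ, mul_right_comm, ← ih hf' hc.deriv]
    simp only [mul_left_comm (f _)] at hparts
    rw [integral_const_mul, neg_mul, neg_inj] at hparts
    rw [← hparts, mul_comm, inv_mul_cancel_left₀ hne]

namespace FlagF1PartialBounds

variable {Cab : ℕ → ℕ → ℝ} {C1 : ℕ → ℝ} {C2 : ℝ} {M : ℝ → ℝ → ℂ}

theorem Cab_nonneg (hM : FlagF1PartialBounds Cab C1 C2 M) (a b : ℕ) : 0 ≤ Cab a b := by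
  simpa using (norm_nonneg _).trans (hM.2.1 a b 0 1 one_ne_zero)

theorem norm_iteratedDeriv_mul_outer_le (hM : FlagF1PartialBounds Cab C1 C2 M) {k : ℕ}
    {W : ℕ → ℝ} {w : ℝ → ℂ} (hw : IsSymbol k W w) (hw0 : ∀ y : ℝ, |y| < 1 / 2 → w y = 0)
    (a : ℕ) (x y : ℝ) :
    ‖iteratedDeriv a (fun x' => iteratedDeriv (k + 1) (fun y' => M x' y' * w y') y) x‖ ≤
      (∑ i ∈ Finset.range (k + 2),
        ((k + 1).choose i : ℝ) * (Cab a i * 2 ^ (1 + a) * 3 ^ (1 + i)) * W (k + 1 - i)) *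
        (1 + |x|) ^ ((-1 : ℤ) - a) * (1 + |y|) ^ (-2 : ℤ) := by
  have hleib : ∀ x' : ℝ, iteratedDeriv (k + 1) (fun y' => M x' y' * w y') y =
      ∑ i ∈ Finset.range (k + 2), ((k + 1).choose i : ℂ) * iteratedDeriv i (M x') y *
        iteratedDeriv (k + 1 - i) w y := fun x' =>
    iteratedDeriv_fun_mul ((hM.1.contDiff_right x').contDiffAt.of_le (by exact_mod_cast le_top))
      (hw.1.contDiffAt.of_le (by exact_mod_cast le_top))
  simp only [hleib]
  rw [iteratedDeriv_fun_sum fun i _ => by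
    refine ContDiffAt.mul (contDiffAt_const.mul ?_) contDiffAt_const
    exact (((hM.1.iteratedDeriv_right i).swap.contDiff_right y).contDiffAt).of_le
      (by exact_mod_cast le_top)]
  simp only [iteratedDeriv_mul_const_field, iteratedDeriv_const_mul_field]
  rw [Finset.sum_mul, Finset.sum_mul]
  refine norm_sum_le_of_le _ fun i hi => ?_
  have hik : i ≤ k + 1 := Nat.lt_succ_iff.1 (Finset.mem_range.1 hi)
  have hCab := hM.Cab_nonneg a i
  have hW := hw.nonneg (k + 1 - i)
  rcases lt_or_ge |y| (1 / 2) with hy | hy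
  · rw [iteratedDeriv_eq_zero_of_eqOn hw0 hy, mul_zero, norm_zero]
    positivity
  · have hy0 : y ≠ 0 := by rintro rfl; norm_num at hy
    have h1 := rpow_le_of_one_add_abs_le two_pos (one_add_abs_le_of_half_le_snd x hy) a
    have h2 := rpow_le_of_one_add_abs_le three_pos (one_add_abs_le_of_half_le hy) i
    have h3 := hw.2 (k + 1 - i) y
    have hpow : (1 + |y|) ^ (-2 : ℤ) =
        (1 + |y|) ^ ((-1 : ℤ) - i) * (1 + |y|) ^ ((k : ℤ) - (k + 1 - i : ℕ)) := by
      rw [← zpow_add₀ (by positivity)]; congr 1; push_cast [hik]; ring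
    rw [norm_mul, norm_mul, Complex.norm_natCast, hpow]
    calc _ ≤ ((k + 1).choose i : ℝ) *
          (Cab a i * (2 ^ (1 + a) * (1 + |x|) ^ ((-1 : ℤ) - a)) *
            (3 ^ (1 + i) * (1 + |y|) ^ ((-1 : ℤ) - i))) *
          (W (k + 1 - i) * (1 + |y|) ^ ((k : ℤ) - (k + 1 - i : ℕ))) := by
          have h4 := (hM.2.1 a i x y hy0).trans (mul_le_mul
            (mul_le_mul_of_nonneg_left h1 hCab) h2 (by positivity) (by positivity))
          exact mul_le_mul (mul_le_mul_of_nonneg_left h4 (Nat.cast_nonneg _)) h3 (norm_nonneg _)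
            (by positivity)
      _ = _ := by ring

theorem exists_isSymbol_outer (Cab : ℕ → ℕ → ℝ) (k : ℕ) : ∃ E : ℕ → ℝ, ∀ (C1 : ℕ → ℝ) (C2 : ℝ)
    (M : ℝ → ℝ → ℂ), FlagF1PartialBounds Cab C1 C2 M → ∀ η : ℝ, |η| = 1 →
      IsSymbol (-1) E (fun x => ∫ y, M x y * ((1 - cutoffC y) * (y : ℂ) ^ k) * chirp η 0 y) := by
  obtain ⟨W, hW⟩ := exists_isSymbol_outerWeight k
  refine ⟨fun a => ‖(2 * π * Complex.I : ℂ)⁻¹‖ ^ (k + 1) * ((∑ i ∈ Finset.range (k + 2),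
    ((k + 1).choose i : ℝ) * (Cab a i * 2 ^ (1 + a) * 3 ^ (1 + i)) * W (k + 1 - i)) *
      ∫ y : ℝ, (1 + |y|) ^ (-2 : ℤ)), fun C1 C2 M hM η hη => ?_⟩
  set w : ℝ → ℂ := fun x => (1 - cutoffC x) * (x : ℂ) ^ k with hw
  have hη0 : η ≠ 0 := by rintro rfl; simp at hη
  have hMw := hM.1.mul_right hW.1
  have hchirp := contDiff_chirp η 0
  have hD := ((hMw.iteratedDeriv_right (k + 1)).mul_right hchirp)
  refine ⟨(hMw.mul_right hchirp).contDiff_integral, fun a x => ?_⟩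
  have heq : (fun x => ∫ y, M x y * w y * chirp η 0 y) = fun x =>
      ((2 * π * Complex.I * η)⁻¹) ^ (k + 1) *
        ∫ y, iteratedDeriv (k + 1) (fun y' => M x y' * w y') y * chirp η 0 y :=
    funext fun x => integral_mul_chirp_zero (hMw.contDiff_right x) (hMw.hasCompactSupport_right x)
      hη0 (k + 1)
  have hnorm : ‖((2 * π * Complex.I * η)⁻¹ : ℂ)‖ = ‖(2 * π * Complex.I : ℂ)⁻¹‖ := by
    rw [norm_inv, norm_mul _ (η : ℂ), Complex.norm_real, norm_eq_abs, hη, mul_one, norm_inv]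
  rw [heq, iteratedDeriv_const_mul_field, norm_mul, norm_pow, hnorm, hD.iteratedDeriv_integral,
    mul_assoc (_ ^ (k + 1))]
  refine mul_le_mul_of_nonneg_left ?_ (by positivity)
  rw [mul_right_comm]
  rw [← integral_const_mul]
  refine norm_integral_le_of_norm_le (integrable_one_add_abs_zpow.const_mul _)
    (Eventually.of_forall fun y => ?_)
  simp only [iteratedDeriv_mul_const_field]
  rw [norm_mul, norm_chirp, mul_one]
  exact hM.norm_iteratedDeriv_mul_outer_le hW (fun y => outerWeight_eq_zero k) a x y

theorem norm_iteratedDeriv_integral_mul_bump_le (hM : FlagF1PartialBounds Cab C1 C2 M) {D : ℝ}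
    (hD : 0 < D) {f : ℝ → ℂ} (hf : IsBumpWith D f) (a : ℕ) {x : ℝ} (hx : x ≠ 0) :
    ‖iteratedDeriv a (fun x => ∫ y, M x y * f y) x‖ ≤ 2 * D * C1 a * |x| ^ (-1 - (a : ℝ)) := by
  obtain ⟨φ, ψ, hφ, hψ, hfe⟩ := hf.exists_normalizedBump hD
  have h1 := hM.1.mul_right hφ.contDiff_ofReal
  have h2 := hM.1.mul_right hψ.contDiff_ofReal
  have heq : (fun x => ∫ y, M x y * f y) = fun x =>
      (D : ℂ) * (∫ y, M x y * φ y) + (D * Complex.I) * ∫ y, M x y * ψ y := by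
    funext x
    rw [← integral_const_mul, ← integral_const_mul, ← integral_add
      ((h1.integrable_right x).const_mul _) ((h2.integrable_right x).const_mul _)]
    refine integral_congr_ae (Eventually.of_forall fun y => ?_)
    simp only [hfe]
    ring
  have hc : ∀ {z : ℂ} {g : ℝ → ℂ}, ContDiff ℝ (⊤ : ℕ∞) g →
      ContDiffAt ℝ a (fun x => z * g x) x := fun hg =>
    (contDiff_const.mul hg).contDiffAt.of_le (by exact_mod_cast le_top)
  rw [heq, iteratedDeriv_fun_add (hc h1.contDiff_integral) (hc h2.contDiff_integral),
    iteratedDeriv_const_mul_field, iteratedDeriv_const_mul_field]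
  have b1 := (hM.2.2 φ hφ 1 one_pos).1 a x hx
  have b2 := (hM.2.2 ψ hψ 1 one_pos).1 a x hx
  simp only [one_mul] at b1 b2
  refine (norm_add_le _ _).trans ?_
  rw [norm_mul, norm_mul, norm_mul, Complex.norm_I, Complex.norm_real, norm_of_nonneg hD.le,
    mul_one]
  calc _ ≤ D * (C1 a * |x| ^ (-1 - (a : ℝ))) + D * (C1 a * |x| ^ (-1 - (a : ℝ))) := by gcongr
    _ = _ := by ring

theorem norm_integral_integral_mul_bump_le (hM : FlagF1PartialBounds Cab C1 C2 M) {D D' : ℝ}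
    (hD : 0 < D) (hD' : 0 < D') {f g : ℝ → ℂ} (hf : IsBumpWith D f) (hg : IsBumpWith D' g) :
    ‖∫ x, (∫ y, M x y * f y) * g x‖ ≤ 4 * D * D' * C2 := by
  obtain ⟨φ, ψ, hφ, hψ, hfe⟩ := hf.exists_normalizedBump hD
  obtain ⟨φ', ψ', hφ', hψ', hge⟩ := hg.exists_normalizedBump hD'
  have hF : ∀ {χ : ℝ → ℝ}, IsNormalizedBump χ → IsTestFun fun x y => M x y * χ y :=
    fun hχ => hM.1.mul_right hχ.contDiff_ofReal
  have hint : ∀ {χ χ' : ℝ → ℝ}, IsNormalizedBump χ → IsNormalizedBump χ' →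
      Integrable fun x => (∫ y, M x y * χ y) * χ' x := fun hχ hχ' =>
    ((hF hχ).contDiff_integral.continuous.mul
      hχ'.contDiff_ofReal.continuous).integrable_of_hasCompactSupport
      (hF hχ).hasCompactSupport_integral.mul_right
  have hb : ∀ {χ χ' : ℝ → ℝ}, IsNormalizedBump χ → IsNormalizedBump χ' →
      ‖∫ x, (∫ y, M x y * χ y) * χ' x‖ ≤ C2 := fun {χ χ'} hχ hχ' => by
    simpa only [one_mul] using (hM.2.2 χ hχ 1 one_pos).2 1 one_pos χ' hχ'
  have heq : ∀ x, ∫ y, M x y * f y =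
      (D : ℂ) * (∫ y, M x y * φ y) + (D * Complex.I) * ∫ y, M x y * ψ y := fun x => by
    rw [← integral_const_mul, ← integral_const_mul, ← integral_add
      (((hF hφ).integrable_right x).const_mul _) (((hF hψ).integrable_right x).const_mul _)]
    refine integral_congr_ae (Eventually.of_forall fun y => ?_)
    simp only [hfe]
    ring
  have hexp : ∫ x, (∫ y, M x y * f y) * g x =
      (D * D' : ℂ) * (∫ x, (∫ y, M x y * φ y) * φ' x) +
      (D * D' * Complex.I) * (∫ x, (∫ y, M x y * φ y) * ψ' x) +
      (D * D' * Complex.I) * (∫ x, (∫ y, M x y * ψ y) * φ' x) +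
      (-(D * D')) * (∫ x, (∫ y, M x y * ψ y) * ψ' x) := by
    simp only [← integral_const_mul]
    have h₁ := (hint hφ hφ').const_mul (D * D' : ℂ)
    have h₂ := (hint hφ hψ').const_mul (D * D' * Complex.I : ℂ)
    have h₃ := (hint hψ hφ').const_mul (D * D' * Complex.I : ℂ)
    have h₄ := (hint hψ hψ').const_mul (-(D * D') : ℂ)
    rw [← integral_add' h₁ h₂, ← integral_add' (h₁.add h₂) h₃,
      ← integral_add' ((h₁.add h₂).add h₃) h₄]
    refine integral_congr_ae (Eventually.of_forall fun x => ?_)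
    simp only [heq, hge, Pi.add_apply]
    linear_combination (D * D' * (∫ y, M x y * ψ y) * ψ' x) * Complex.I_sq
  rw [hexp]
  have hP : 0 ≤ D * D' := by positivity
  calc _ ≤ D * D' * C2 + D * D' * C2 + D * D' * C2 + D * D' * C2 := by
        refine norm_add_le_of_le (norm_add_le_of_le (norm_add_le_of_le ?_ ?_) ?_) ?_ <;>
        simp only [norm_mul, norm_neg, Complex.norm_I, mul_one, Complex.norm_real,
          norm_of_nonneg hD.le, norm_of_nonneg hD'.le] <;>
        exact mul_le_mul_of_nonneg_left (hb (by assumption) (by assumption)) hP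
    _ = _ := by ring

end FlagF1PartialBounds

theorem IsSymbol.outerWeight_mul {j : ℕ} {W C : ℕ → ℝ} {t : ℤ}
    (hW : IsSymbol j W (fun x => (1 - cutoffC x) * (x : ℂ) ^ j)) {f : ℝ → ℂ}
    (hf : ContDiff ℝ (⊤ : ℕ∞) f) (hC : ∀ a, 0 ≤ C a)
    (hfx : ∀ x : ℝ, 1 / 2 ≤ |x| → ∀ a : ℕ, ‖iteratedDeriv a f x‖ ≤ C a * (1 + |x|) ^ (t - a)) :
    IsSymbol (j + t) (leibnizBound W C) (fun x => (1 - cutoffC x) * (x : ℂ) ^ j * f x) := by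
  refine ⟨hW.1.mul hf, fun a x => ?_⟩
  rcases lt_or_ge |x| (1 / 2) with hx | hx
  · rw [iteratedDeriv_eq_zero_of_eqOn (fun y hy => by rw [outerWeight_eq_zero j hy, zero_mul]) hx,
      norm_zero]
    refine mul_nonneg (Finset.sum_nonneg fun i _ => ?_) (by positivity)
    exact mul_nonneg (mul_nonneg (Nat.cast_nonneg _) (hW.nonneg i)) (hC _)
  · exact norm_iteratedDeriv_mul_le hW.1 hf (fun i => hW.2 i x) (hfx x hx) a

namespace FlagF1PartialBounds

theorem exists_bound_integral_mul_chirp (B : ℝ) {m : ℝ} (hm : 0 < m) (Cab : ℕ → ℕ → ℝ)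
    (C1 : ℕ → ℝ) (C2 : ℝ) (j k : ℕ) :
    ∃ C, ∀ M : ℝ → ℝ → ℂ, FlagF1PartialBounds Cab C1 C2 M → ∀ ξ η : ℝ, |ξ| ≤ B → |η| = 1 →
      ‖∫ x : ℝ, ((x : ℂ) ^ j * ∫ y, M x y * (y : ℂ) ^ k * chirp η 0 y) *
        chirp ξ (m * η) x‖ ≤ C := by
  obtain ⟨W, hW⟩ := exists_isSymbol_outerWeight j
  obtain ⟨X, hX⟩ := IsSymbol.pow j
  obtain ⟨E, hE⟩ := exists_isSymbol_outer Cab k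
  have hpow : ∀ n : ℕ, ContDiff ℝ (⊤ : ℕ∞) fun y : ℝ => (y : ℂ) ^ n := fun n =>
    Complex.ofRealCLM.contDiff.pow n
  have hsupp : ∀ (n : ℕ) (t : ℝ), 1 < |t| → cutoffC t * (t : ℂ) ^ n = 0 := fun n t ht => by
    rw [cutoffC_eq_zero ht, zero_mul]
  obtain ⟨D, hD, hDb⟩ := exists_isBumpWith_mul_chirp (contDiff_cutoffC.mul (hpow k)) (hsupp k) 1 0
  obtain ⟨D', hD', hDb'⟩ :=
    exists_isBumpWith_mul_chirp (contDiff_cutoffC.mul (hpow j)) (hsupp j) B m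
  set A : ℕ → ℝ := fun a => 2 * D * C1 a * 3 ^ (1 + a) with hA
  obtain ⟨I₁, hI₁⟩ := exists_bound_integral_symbol_mul_chirp (B := B) hm (j + (-1))
    (leibnizBound W A)
  obtain ⟨I₂, hI₂⟩ := exists_bound_integral_symbol_mul_chirp (B := B) hm (j + (-1))
    (leibnizBound X E)
  refine ⟨4 * D * D' * C2 + I₁ + I₂, fun M hM ξ η hξ hη => ?_⟩
  have hμ : |m * η| = m := by rw [abs_mul, hη, mul_one, abs_of_pos hm]
  have hbk := hDb η 0 hη.le (by simp)
  have hbj := hDb' ξ (m * η) hξ hμ.le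
  have hG := hE C1 C2 M hM η hη
  have hchirp := contDiff_chirp η 0
  have hchirpξ := (contDiff_chirp ξ (m * η)).continuous
  have hPtest := hM.1.mul_right hbk.1
  have hGtest := (hM.1.mul_right
    (((contDiff_const (c := (1 : ℂ))).sub contDiff_cutoffC).mul (hpow k))).mul_right hchirp
  set P : ℝ → ℂ := fun x => ∫ y, M x y * (cutoffC y * (y : ℂ) ^ k * chirp η 0 y) with hP
  set G : ℝ → ℂ := fun x => ∫ y, M x y * ((1 - cutoffC y) * (y : ℂ) ^ k) * chirp η 0 y with hGdef
  have hPc := hPtest.contDiff_integral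
  have hPs := hPtest.hasCompactSupport_integral
  have hGs := hGtest.hasCompactSupport_integral
  have hPb : ∀ x : ℝ, x ≠ 0 → ∀ a : ℕ,
      ‖iteratedDeriv a P x‖ ≤ 2 * D * C1 a * |x| ^ (-1 - (a : ℝ)) := fun x hx a =>
    hM.norm_iteratedDeriv_integral_mul_bump_le hD hbk a hx
  have hC1 : ∀ a, 0 ≤ 2 * D * C1 a := fun a => by
    simpa using (norm_nonneg _).trans (hPb 1 one_ne_zero a)
  have hPsym := hW.outerWeight_mul (t := -1) (C := A) hPc
    (fun a => mul_nonneg (hC1 a) (by positivity)) fun x hx a => by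
      have hx0 : x ≠ 0 := by rintro rfl; norm_num at hx
      have h := rpow_le_of_one_add_abs_le three_pos (one_add_abs_le_of_half_le hx) a
      refine (hPb x hx0 a).trans ?_
      rw [hA, mul_assoc _ ((3 : ℝ) ^ _)]
      exact mul_le_mul_of_nonneg_left h (hC1 a)
  have hsplit : ∀ x : ℝ,
      ((x : ℂ) ^ j * ∫ y, M x y * (y : ℂ) ^ k * chirp η 0 y) * chirp ξ (m * η) x =
      P x * (cutoffC x * (x : ℂ) ^ j * chirp ξ (m * η) x) +
        ((1 - cutoffC x) * (x : ℂ) ^ j * P x) * chirp ξ (m * η) x +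
        ((x : ℂ) ^ j * G x) * chirp ξ (m * η) x := fun x => by
    have : ∫ y, M x y * (y : ℂ) ^ k * chirp η 0 y = P x + G x := by
      rw [hP, hGdef, ← integral_add (hPtest.integrable_right x) (hGtest.integrable_right x)]
      exact integral_congr_ae (Eventually.of_forall fun y => by ring)
    rw [this]
    ring
  have hint : ∀ {w u : ℝ → ℂ}, Continuous w → Continuous u → HasCompactSupport u →
      Integrable fun x => w x * u x * chirp ξ (m * η) x := fun hw hu hs =>
    ((hw.mul hu).mul hchirpξ).integrable_of_hasCompactSupport (hs.mul_left.mul_right)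
  simp only [hsplit]
  rw [integral_add, integral_add]
  · refine norm_add_le_of_le (norm_add_le_of_le ?_ ?_) ?_
    · exact hM.norm_integral_integral_mul_bump_le hD hD' hbk hbj
    · exact hI₁ _ _ _ hξ hμ hPsym hPs.mul_left
    · exact hI₂ _ _ _ hξ hμ (hX.mul hG) hGs.mul_left
  · exact (hPc.continuous.mul hbj.1.continuous).integrable_of_hasCompactSupport hPs.mul_right
  · exact hint hW.1.continuous hPc.continuous hPs
  · refine Integrable.add ?_ (hint hW.1.continuous hPc.continuous hPs)
    exact (hPc.continuous.mul hbj.1.continuous).integrable_of_hasCompactSupport hPs.mul_right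
  · exact hint hX.1.continuous hG.1.continuous hGs

end FlagF1PartialBounds

theorem FlagF1FunBounds.partialBounds {Cab : ℕ → ℕ → ℝ} {C1 : ℕ → ℝ} {C2 : ℝ} {M : ℝ → ℝ → ℂ}
    (hM : FlagF1FunBounds Cab C1 C2 M) : FlagF1PartialBounds Cab C1 C2 M :=
  ⟨⟨hM.1, hM.2.1⟩, hM.2.2.1, fun φ hφ R hR => (hM.2.2.2 φ hφ R hR).2.2⟩

/-- The parabolic rescaling of a kernel, of the same homogeneity as a kernel of type `F₁`. -/
def parabolicScale (l : ℝ) (M : ℝ → ℝ → ℂ) (x y : ℝ) : ℂ := (l : ℂ) ^ 3 * M (l * x) (l ^ 2 * y)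

theorem IsTestFun.parabolicScale {l : ℝ} (hl : 0 < l) {M : ℝ → ℝ → ℂ} (hM : IsTestFun M) :
    IsTestFun (parabolicScale l M) := by
  refine ⟨contDiff_const.mul (hM.1.comp ((contDiff_const.mul contDiff_fst).prodMk
    (contDiff_const.mul contDiff_snd))), HasCompactSupport.mul_left ?_⟩
  exact hM.2.comp_homeomorph ((Homeomorph.mulLeft₀ l hl.ne').prodCongr
    (Homeomorph.mulLeft₀ (l ^ 2) (pow_pos hl 2).ne'))

theorem rpow_neg_one_sub_mul {l u : ℝ} (hl : 0 < l) (hu : 0 ≤ u) (n : ℕ) :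
    l ^ (n + 1) * (l * u) ^ (-1 - (n : ℝ)) = u ^ (-1 - (n : ℝ)) := by
  rw [Real.mul_rpow hl.le hu, ← mul_assoc, ← Real.rpow_natCast, ← Real.rpow_add hl,
    show ((n + 1 : ℕ) : ℝ) + (-1 - n) = 0 by push_cast; ring, Real.rpow_zero, one_mul]

namespace FlagF1PartialBounds

variable {Cab : ℕ → ℕ → ℝ} {C1 : ℕ → ℝ} {C2 : ℝ} {M : ℝ → ℝ → ℂ}

theorem parabolicScale (hM : FlagF1PartialBounds Cab C1 C2 M) {l : ℝ} (hl : 0 < l) :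
    FlagF1PartialBounds Cab C1 C2 (parabolicScale l M) := by
  have hl2 : 0 < l ^ 2 := by positivity
  have hlc : (l : ℂ) ≠ 0 := by exact_mod_cast hl.ne'
  refine ⟨hM.1.parabolicScale hl, fun a b x y hy => ?_, fun φ hφ R hR => ?_⟩
  · have h1 : ∀ x', iteratedDeriv b (fun y' => _root_.parabolicScale l M x' y') y =
        ((l : ℂ) ^ 3 * ((l ^ 2) ^ b : ℝ)) * iteratedDeriv b (M (l * x')) (l ^ 2 * y) := fun x' => by
      have h := (hM.1.contDiff_right (l * x')).of_le (m := b) (by exact_mod_cast le_top)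
      simp only [_root_.parabolicScale]
      rw [iteratedDeriv_const_mul_field, iteratedDeriv_comp_const_smul h]
      simp only [Complex.real_smul]
      ring
    have h2 := ((hM.1.iteratedDeriv_right b).swap.contDiff_right (l ^ 2 * y)).of_le (m := a)
      (by exact_mod_cast le_top)
    simp only [h1]
    rw [iteratedDeriv_const_mul_field, iteratedDeriv_comp_const_smul h2]
    dsimp only
    rw [norm_mul, norm_smul, norm_mul, norm_pow, Complex.norm_real,
      Complex.norm_real, norm_of_nonneg hl.le, norm_of_nonneg (by positivity),
      norm_of_nonneg (by positivity)]
    have h2 := hM.2.1 a b (l * x) (l ^ 2 * y) (mul_ne_zero hl2.ne' hy)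
    have hroot : |l ^ 2 * y| ^ ((1 : ℝ) / 2) = l * |y| ^ ((1 : ℝ) / 2) := by
      rw [abs_mul, abs_of_pos hl2, ← Real.sqrt_eq_rpow, ← Real.sqrt_eq_rpow,
        Real.sqrt_mul hl2.le, Real.sqrt_sq hl.le]
    rw [hroot, abs_mul, abs_mul, abs_of_pos hl, abs_of_pos hl2, ← mul_add] at h2
    calc _ ≤ l ^ 3 * (l ^ 2) ^ b * (l ^ a * (Cab a b *
          (l * (|x| + |y| ^ ((1 : ℝ) / 2))) ^ (-1 - (a : ℝ)) *
            (l ^ 2 * |y|) ^ (-1 - (b : ℝ)))) := by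
          gcongr
      _ = Cab a b * (l ^ (a + 1) * (l * (|x| + |y| ^ ((1 : ℝ) / 2))) ^ (-1 - (a : ℝ))) *
          ((l ^ 2) ^ (b + 1) * (l ^ 2 * |y|) ^ (-1 - (b : ℝ))) := by ring
      _ = _ := by
          rw [rpow_neg_one_sub_mul hl (by positivity), rpow_neg_one_sub_mul hl2 (by positivity)]
  · have hR' : 0 < R / l ^ 2 := by positivity
    obtain ⟨h1, h2⟩ := hM.2.2 φ hφ (R / l ^ 2) hR'
    have hint : ∀ x, ∫ y, _root_.parabolicScale l M x y * (φ (R * y) : ℂ) =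
        l * ∫ y, M (l * x) y * (φ (R / l ^ 2 * y) : ℂ) := fun x => by
      have h := Measure.integral_comp_mul_left
        (fun y => (l : ℂ) ^ 3 * (M (l * x) y * (φ (R / l ^ 2 * y) : ℂ))) (l ^ 2)
      rw [abs_of_pos (inv_pos.2 hl2), Complex.real_smul,
        integral_const_mul _ (fun y => M (l * x) y * _), ← mul_assoc] at h
      convert h using 1
      · refine integral_congr_ae (Eventually.of_forall fun y => ?_)
        simp only [_root_.parabolicScale]
        rw [show R / l ^ 2 * (l ^ 2 * y) = R * y by field_simp, mul_assoc]
      · congr 1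
        push_cast
        field_simp
    have htest : IsTestFun fun x y => M x y * (φ (R / l ^ 2 * y) : ℂ) :=
      hM.1.mul_right (hφ.contDiff_ofReal.comp (contDiff_const.mul contDiff_id))
    simp only [hint]
    refine ⟨fun a x hx => ?_, fun δ hδ ψ hψ => ?_⟩
    · rw [iteratedDeriv_const_mul_field, iteratedDeriv_comp_const_smul
        (f := fun x : ℝ => ∫ y, M x y * (φ (R / l ^ 2 * y) : ℂ))
        (htest.contDiff_integral.of_le (by exact_mod_cast le_top))]
      dsimp only
      rw [norm_mul, norm_smul,
        Complex.norm_real, norm_of_nonneg hl.le, norm_of_nonneg (by positivity)]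
      have h := h1 a (l * x) (mul_ne_zero hl.ne' hx)
      rw [abs_mul, abs_of_pos hl] at h
      calc _ ≤ l * (l ^ a * (C1 a * (l * |x|) ^ (-1 - (a : ℝ)))) := by gcongr
        _ = C1 a * (l ^ (a + 1) * (l * |x|) ^ (-1 - (a : ℝ))) := by ring
        _ = _ := by rw [rpow_neg_one_sub_mul hl (abs_nonneg x)]
    · have h := Measure.integral_comp_mul_left
        (fun x => (l : ℂ) * (∫ y, M x y * (φ (R / l ^ 2 * y) : ℂ)) * (ψ (δ / l * x) : ℂ)) l
      rw [abs_of_pos (inv_pos.2 hl), Complex.real_smul] at h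
      simp only [mul_assoc (l : ℂ)] at h
      rw [integral_const_mul _ fun x => (∫ y, M x y * (φ (R / l ^ 2 * y) : ℂ)) * _,
        Complex.ofReal_inv, inv_mul_cancel_left₀ hlc] at h
      have hψ' : ∀ x, δ / l * (l * x) = δ * x := fun x => by field_simp
      simp only [hψ'] at h
      simp only [mul_assoc (l : ℂ)]
      rw [h]
      exact h2 _ (by positivity) ψ hψ

end FlagF1PartialBounds

theorem mul_integral_comp_mul_left {l : ℝ} (hl : 0 < l) (g : ℝ → ℂ) :
    (l : ℂ) * ∫ x, g (l * x) = ∫ x, g x := by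
  have hlc : (l : ℂ) ≠ 0 := by exact_mod_cast hl.ne'
  rw [Measure.integral_comp_mul_left, abs_of_pos (inv_pos.2 hl), Complex.real_smul,
    Complex.ofReal_inv, mul_inv_cancel_left₀ hlc]

/-- The moment of `M` of order `(j, k)` against the oscillation `exp(-2πi(xξ + (y + mx²)η))`. -/
def curvedMoment (m : ℝ) (j k : ℕ) (M : ℝ → ℝ → ℂ) (ξ η : ℝ) : ℂ :=
  ∫ x : ℝ, ((x : ℂ) ^ j * ∫ y, M x y * (y : ℂ) ^ k * chirp η 0 y) * chirp ξ (m * η) x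

theorem chirp_mul (l b μ x : ℝ) : chirp (l * b) (l ^ 2 * μ) x = chirp b μ (l * x) := by
  simp only [chirp]
  congr 1
  ring

theorem curvedMoment_parabolicScale {l : ℝ} (hl : 0 < l) (m : ℝ) (j k : ℕ) (M : ℝ → ℝ → ℂ)
    (ξ η : ℝ) : (l : ℂ) ^ (j + 2 * k) *
      curvedMoment m j k (parabolicScale l M) (l * ξ) (l ^ 2 * η) = curvedMoment m j k M ξ η := by
  have hinner : ∀ x, (l : ℂ) ^ (2 * k) *
      ∫ y, parabolicScale l M x y * (y : ℂ) ^ k * chirp (l ^ 2 * η) 0 y =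
      l * ∫ y, M (l * x) y * (y : ℂ) ^ k * chirp η 0 y := fun x => by
    rw [← mul_integral_comp_mul_left (pow_pos hl 2) fun y =>
        M (l * x) y * (y : ℂ) ^ k * chirp η 0 y,
      ← mul_assoc, ← integral_const_mul, ← integral_const_mul]
    refine integral_congr_ae (Eventually.of_forall fun y => ?_)
    have h := chirp_mul (l ^ 2) η 0 y
    rw [mul_zero] at h
    simp only [h, parabolicScale]
    push_cast
    ring
  unfold curvedMoment
  rw [← mul_integral_comp_mul_left hl fun x : ℝ =>
    ((x : ℂ) ^ j * ∫ y, M x y * (y : ℂ) ^ k * chirp η 0 y) * chirp ξ (m * η) x,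
    ← integral_const_mul, ← integral_const_mul]
  refine integral_congr_ae (Eventually.of_forall fun x => ?_)
  have h := chirp_mul l ξ (m * η) x
  rw [mul_left_comm] at h
  simp only [h]
  calc _ = (l : ℂ) ^ j * (x : ℂ) ^ j * ((l : ℂ) ^ (2 * k) *
        ∫ y, parabolicScale l M x y * (y : ℂ) ^ k * chirp (l ^ 2 * η) 0 y) *
        chirp ξ (m * η) (l * x) := by ring
    _ = _ := by
        rw [hinner]
        push_cast
        ring

theorem FlagF1PartialBounds.exists_bound_curvedMoment (B : ℝ) {m : ℝ} (hm : 0 < m)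
    (Cab : ℕ → ℕ → ℝ) (C1 : ℕ → ℝ) (C2 : ℝ) (j k : ℕ) :
    ∃ C, ∀ M : ℝ → ℝ → ℂ, FlagF1PartialBounds Cab C1 C2 M → ∀ ξ η : ℝ, η ≠ 0 →
      |ξ| ≤ B * √|η| → ‖curvedMoment m j k M ξ η‖ ≤ C * (√|η|)⁻¹ ^ (j + 2 * k) := by
  obtain ⟨C, hC⟩ := exists_bound_integral_mul_chirp B hm Cab C1 C2 j k
  refine ⟨C, fun M hM ξ η hη hξ => ?_⟩
  have hs : 0 < √|η| := Real.sqrt_pos.2 (abs_pos.2 hη)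
  set l := (√|η|)⁻¹ with hl
  have hl0 : 0 < l := inv_pos.2 hs
  have hsq : l ^ 2 * |η| = 1 := by
    rw [hl, inv_pow, Real.sq_sqrt (abs_nonneg η), inv_mul_cancel₀ (abs_ne_zero.2 hη)]
  have h := hC _ (hM.parabolicScale hl0) (l * ξ) (l ^ 2 * η)
    (by rw [abs_mul, abs_of_pos hl0, hl, inv_mul_le_iff₀ hs, mul_comm]; exact hξ)
    (by rw [abs_mul, abs_of_pos (pow_pos hl0 2), hsq])
  rw [← curvedMoment_parabolicScale hl0, norm_mul, norm_pow, Complex.norm_real,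
    norm_of_nonneg hl0.le, mul_comm]
  exact mul_le_mul_of_nonneg_right h (by positivity)

theorem iteratedDeriv_integral_eI_mul {f : ℝ × ℝ → ℂ} (hf : Continuous f)
    (hc : HasCompactSupport f) {h u : ℝ × ℝ → ℝ} (hh : Continuous h) (hu : Continuous u) (n : ℕ) :
    iteratedDeriv n (fun t => ∫ p, eI (-2 * π * (h p + u p * t)) * f p) =
      fun t => ∫ p, eI (-2 * π * (h p + u p * t)) * ((-2 * π * Complex.I * u p) ^ n * f p) := by
  induction n with
  | zero => simp
  | succ n ih =>
    rw [iteratedDeriv_succ, ih]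
    funext t
    have hcont : ∀ N : ℕ, Continuous fun q : ℝ × (ℝ × ℝ) =>
        eI (-2 * π * (h q.2 + u q.2 * q.1)) * ((-2 * π * Complex.I * u q.2) ^ N * f q.2) :=
      fun N => by
      have := contDiff_eI.continuous
      fun_prop
    have hzero : ∀ (N : ℕ) (t : ℝ), ∀ p ∉ tsupport f,
        eI (-2 * π * (h p + u p * t)) * ((-2 * π * Complex.I * u p) ^ N * f p) = 0 :=
      fun N t p hp => by rw [image_eq_zero_of_notMem_tsupport hp, mul_zero, mul_zero]
    refine (hasDerivAt_integral_of_support_compact hc.isCompact (hcont n) (hcont (n + 1))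
      (hzero n) (hzero (n + 1)) (fun t p => ?_) t).deriv
    have hd : HasDerivAt (fun t : ℝ => -2 * π * (h p + u p * t)) (-2 * π * u p) t := by
      simpa using (((hasDerivAt_id t).const_mul (u p)).const_add (h p)).const_mul (-2 * π)
    refine (hd.eI.mul_const _).congr_deriv ?_
    push_cast
    ring

theorem hasCompactSupport_shear {M : ℝ → ℝ → ℂ} (hM : IsTestFun M) (m : ℝ) :
    HasCompactSupport fun p : ℝ × ℝ => M p.1 (p.2 - m * p.1 ^ 2) := by
  have hS : Continuous fun p : ℝ × ℝ => (p.1, p.2 + m * p.1 ^ 2) := by fun_prop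
  refine HasCompactSupport.intro (hM.2.isCompact.image hS) fun p hp => ?_
  by_contra h
  exact hp ⟨(p.1, p.2 - m * p.1 ^ 2), subset_tsupport _ h, by simp⟩

theorem iteratedDeriv_fourier_shear {M : ℝ → ℝ → ℂ} (hM : IsTestFun M) (m : ℝ) (a b : ℕ) (ξ η : ℝ) :
    iteratedDeriv a (fun ξ' : ℝ => iteratedDeriv b (fun η' : ℝ => ∫ p : ℝ × ℝ,
      eI (-2 * π * (p.1 * ξ' + p.2 * η')) * M p.1 (p.2 - m * p.1 ^ 2)) η) ξ =
    (-2 * π * Complex.I) ^ (a + b) * ∑ k ∈ Finset.range (b + 1),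
      ((m : ℂ) ^ (b - k) * (b.choose k : ℂ)) * curvedMoment m (a + 2 * (b - k)) k M ξ η := by
  have hK : Continuous fun p : ℝ × ℝ => M p.1 (p.2 - m * p.1 ^ 2) :=
    hM.1.continuous.comp (f := fun p : ℝ × ℝ => (p.1, p.2 - m * p.1 ^ 2)) (by fun_prop)
  have hKs := hasCompactSupport_shear hM m
  have h1 : ∀ ξ' : ℝ, iteratedDeriv b (fun η' : ℝ => ∫ p : ℝ × ℝ,
      eI (-2 * π * (p.1 * ξ' + p.2 * η')) * M p.1 (p.2 - m * p.1 ^ 2)) η =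
      ∫ p : ℝ × ℝ, eI (-2 * π * (p.2 * η + p.1 * ξ')) *
        ((-2 * π * Complex.I * p.2) ^ b * M p.1 (p.2 - m * p.1 ^ 2)) := fun ξ' => by
    rw [iteratedDeriv_integral_eI_mul hK hKs (h := fun p => p.1 * ξ') (u := fun p => p.2)
      (by fun_prop) (by fun_prop)]
    simp only [add_comm]
  have hKb : Continuous fun p : ℝ × ℝ =>
      (-2 * π * Complex.I * p.2) ^ b * M p.1 (p.2 - m * p.1 ^ 2) :=
    (by fun_prop : Continuous fun p : ℝ × ℝ => (-2 * π * Complex.I * p.2 : ℂ) ^ b).mul hK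
  have hKbs : HasCompactSupport fun p : ℝ × ℝ =>
      (-2 * π * Complex.I * p.2) ^ b * M p.1 (p.2 - m * p.1 ^ 2) := hKs.mul_left
  simp only [h1]
  rw [iteratedDeriv_integral_eI_mul hKb hKbs (h := fun p => p.2 * η) (u := fun p => p.1)
    (by fun_prop) (by fun_prop)]
  dsimp only
  rw [Measure.volume_eq_prod, integral_prod]
  swap
  · rw [← Measure.volume_eq_prod]
    refine Continuous.integrable_of_hasCompactSupport ?_ hKbs.mul_left.mul_left
    have := contDiff_eI.continuous
    fun_prop
  have hmom : ∀ k, IsTestFun fun x y => M x y * (y : ℂ) ^ k * chirp η 0 y := fun k =>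
    (hM.mul_right (Complex.ofRealCLM.contDiff.pow k)).mul_right (contDiff_chirp η 0)
  have hinner : ∀ x : ℝ, ∫ y : ℝ, eI (-2 * π * (y * η + x * ξ)) * ((-2 * π * Complex.I * x) ^ a *
      ((-2 * π * Complex.I * y) ^ b * M x (y - m * x ^ 2))) =
      (-2 * π * Complex.I) ^ (a + b) * ∑ k ∈ Finset.range (b + 1),
        ((m : ℂ) ^ (b - k) * (b.choose k : ℂ)) * (((x : ℂ) ^ (a + 2 * (b - k)) *
          ∫ y, M x y * (y : ℂ) ^ k * chirp η 0 y) * chirp ξ (m * η) x) := fun x => by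
    rw [← integral_add_right_eq_self _ (m * x ^ 2)]
    simp only [← integral_const_mul, ← integral_mul_const]
    rw [← integral_finsetSum, ← integral_const_mul]
    · refine integral_congr_ae (Eventually.of_forall fun y => ?_)
      have he : eI (-2 * π * ((y + m * x ^ 2) * η + x * ξ)) = chirp η 0 y * chirp ξ (m * η) x := by
        rw [chirp, chirp, ← eI_add]
        congr 1
        ring
      dsimp only
      rw [he, add_sub_cancel_right, mul_pow _ (((y + m * x ^ 2 : ℝ) : ℝ) : ℂ), Complex.ofReal_add,
        add_pow, mul_pow _ (x : ℂ), pow_add]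
      simp only [Finset.mul_sum, Finset.sum_mul]
      refine Finset.sum_congr rfl fun k _ => ?_
      push_cast
      ring
    · exact fun k _ => (((hmom k).integrable_right x).const_mul _).mul_const _ |>.const_mul _
  simp only [hinner]
  rw [integral_const_mul, integral_finsetSum]
  · simp only [integral_const_mul, curvedMoment]
  · intro k _
    refine Integrable.const_mul (Continuous.integrable_of_hasCompactSupport ?_
      (hmom k).hasCompactSupport_integral.mul_left.mul_right) _
    have h2 := (hmom k).contDiff_integral.continuous
    have h3 := (contDiff_chirp ξ (m * η)).continuous
    exact ((by fun_prop : Continuous fun x : ℝ => (x : ℂ) ^ (a + 2 * (b - k))).mul h2).mul h3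

/-- For `M` satisfying the flag-`F₁` seminorm bounds and
`K(x,y) = M(x, y - c₀x²)`, the Fourier transform `m` of `K` satisfies, on the region
`|η| > c|ξ|² > 0`, the Mikhlin multiplier estimates for the nonisotropic dilations
`(ξ,η) ↦ (λξ, λ²η)`, with constants independent of the support of `M`. -/
theorem curved_multiplier_Mikhlin_above_parabola (c₀ c : ℝ) (hc₀ : 0 < c₀) (hc : 0 < c)
    (Cab : ℕ → ℕ → ℝ) (C1 : ℕ → ℝ) (C2 : ℝ) :
    ∀ α β : ℕ, ∃ Cb : ℝ, ∀ M : ℝ → ℝ → ℂ, FlagF1FunBounds Cab C1 C2 M →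
      ∀ ξ η : ℝ, ξ ≠ 0 → c * ξ ^ 2 < |η| →
        ‖iteratedDeriv α
            (fun ξ' : ℝ => iteratedDeriv β
              (fun η' : ℝ => ∫ p : ℝ × ℝ,
                eI (-2 * π * (p.1 * ξ' + p.2 * η')) * M p.1 (p.2 - c₀ * p.1 ^ 2)) η) ξ‖
          ≤ Cb * (|ξ| + |η| ^ ((1:ℝ)/2)) ^ (-(α : ℝ) - 2 * β) := by
  intro α β
  set B : ℝ := √(1 / c) with hB
  choose C hC using fun k =>
    FlagF1PartialBounds.exists_bound_curvedMoment B hc₀ Cab C1 C2 (α + 2 * (β - k)) k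
  refine ⟨(2 * π) ^ (α + β) * (∑ k ∈ Finset.range (β + 1), c₀ ^ (β - k) * β.choose k * |C k|) *
    (B + 1) ^ (α + 2 * β), fun M hM ξ η hξ hcξ => ?_⟩
  have hη : 0 < |η| := lt_of_le_of_lt (by positivity) hcξ
  have hs : 0 < √|η| := Real.sqrt_pos.2 hη
  have hξB : |ξ| ≤ B * √|η| := by
    rw [hB, ← Real.sqrt_mul (by positivity)]
    refine Real.abs_le_sqrt ?_
    rw [div_mul_eq_mul_div, one_mul, le_div_iff₀ hc, mul_comm]
    exact hcξ.le
  have hsum : 0 < |ξ| + √|η| := by positivity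
  have hinv : (√|η|)⁻¹ ≤ (B + 1) * (|ξ| + √|η|)⁻¹ := by
    rw [← div_eq_mul_inv, le_div_iff₀ hsum, inv_mul_le_iff₀ hs]
    linarith
  have hpow : (|ξ| + |η| ^ ((1 : ℝ) / 2)) ^ (-(α : ℝ) - 2 * β) =
      (|ξ| + √|η|)⁻¹ ^ (α + 2 * β) := by
    rw [← Real.sqrt_eq_rpow, show -(α : ℝ) - 2 * β = -((α + 2 * β : ℕ) : ℝ) by push_cast; ring,
      Real.rpow_neg hsum.le, Real.rpow_natCast, inv_pow]
  have h2π : ‖(-2 * π * Complex.I : ℂ)‖ = 2 * π := by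
    simp [abs_of_pos Real.pi_pos]
  rw [iteratedDeriv_fourier_shear hM.partialBounds.1, hpow, norm_mul, norm_pow, h2π, mul_assoc,
    mul_assoc, ← mul_pow]
  refine mul_le_mul_of_nonneg_left ?_ (by positivity)
  rw [Finset.sum_mul]
  refine norm_sum_le_of_le _ fun k hk => ?_
  have hk' : k ≤ β := Nat.lt_succ_iff.1 (Finset.mem_range.1 hk)
  have h := hC k M hM.partialBounds ξ η (abs_pos.1 hη) hξB
  rw [show α + 2 * (β - k) + 2 * k = α + 2 * β by omega] at h
  rw [norm_mul, norm_mul, norm_pow, Complex.norm_real, Complex.norm_natCast,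
    norm_of_nonneg hc₀.le, mul_assoc _ |C k|]
  refine mul_le_mul_of_nonneg_left (h.trans ?_) (by positivity)
  gcongr
  exact le_abs_self _
end
end

section
/- Let M be a C^∞ function on ℝ² ∖ {x = 0} satisfying the flag-F₂ differential inequalities |∂_x^α ∂_y^β M(x,y)| ≤ C_{α,β}|x|^{−1−α}(x² + |y|)^{−1−β} for all α, β ∈ ℕ and all x ≠ 0. Then for any constant c ∈ ℝ, the function M_c(x,y) := M(x, y − cx²) is C^∞ on ℝ² ∖ {x = 0} and satisfies the same flag-F₂ differential inequalities |∂_x^α ∂_y^β M_c(x,y)| ≤ C'_{α,β}|x|^{−1−α}(x² + |y|)^{−1−β}, with constants C'_{α,β} depending only on c, α, β and finitely many of the constants C_{α,β}. -/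
open Real Filter Topology MeasureTheory ENNReal NNReal

noncomputable section

/-- The derivative of `f` in the fixed direction `v`, as a function of the base point. -/
def dirDeriv {E F : Type*} [NormedAddCommGroup E] [NormedSpace ℝ E] [NormedAddCommGroup F]
    [NormedSpace ℝ F] (v : E) (f : E → F) (p : E) : F :=
  fderiv ℝ f p v

section dirDeriv

variable {E F : Type*} [NormedAddCommGroup E] [NormedSpace ℝ E] [NormedAddCommGroup F]
  [NormedSpace ℝ F] {f g : E → F} {U : Set E}

lemma ContDiffOn.dirDeriv (hf : ContDiffOn ℝ (⊤ : ℕ∞) f U) (hU : IsOpen U) (v : E) :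
    ContDiffOn ℝ (⊤ : ℕ∞) (dirDeriv v f) U :=
  (hf.fderiv_of_isOpen hU le_rfl).clm_apply contDiffOn_const

lemma ContDiffOn.iterate_dirDeriv (hf : ContDiffOn ℝ (⊤ : ℕ∞) f U) (hU : IsOpen U) (v : E)
    (n : ℕ) : ContDiffOn ℝ (⊤ : ℕ∞) ((_root_.dirDeriv v)^[n] f) U := by
  induction n with
  | zero => exact hf
  | succ n ih =>
    rw [Function.iterate_succ_apply']
    exact ih.dirDeriv hU v

lemma Set.EqOn.dirDeriv (h : Set.EqOn f g U) (hU : IsOpen U) (v : E) :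
    Set.EqOn (dirDeriv v f) (dirDeriv v g) U := fun p hp => by
  have : f =ᶠ[𝓝 p] g := by
    filter_upwards [hU.mem_nhds hp] with q hq using h hq
  simp only [_root_.dirDeriv, this.fderiv_eq]

lemma dirDeriv_comm (hf : ContDiffOn ℝ (⊤ : ℕ∞) f U) (hU : IsOpen U) (v w : E) :
    Set.EqOn (dirDeriv v (dirDeriv w f)) (dirDeriv w (dirDeriv v f)) U := fun p hp => by
  have hd : DifferentiableAt ℝ (fderiv ℝ f) p :=
    ((hf.fderiv_of_isOpen (m := (⊤ : ℕ∞)) hU le_rfl).contDiffAt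
      (hU.mem_nhds hp)).differentiableAt (by simp)
  have hs : IsSymmSndFDerivAt ℝ f p :=
    (hf.contDiffAt (hU.mem_nhds hp)).isSymmSndFDerivAt
      (by simpa using WithTop.coe_le_coe.2 (le_top : (2 : ℕ∞) ≤ ⊤))
  have key : ∀ a b : E, dirDeriv a (dirDeriv b f) p = fderiv ℝ (fderiv ℝ f) p a b := by
    intro a b
    have h := hd.hasFDerivAt.clm_apply (hasFDerivAt_const b p)
    change fderiv ℝ (fun q => fderiv ℝ f q b) p a = _
    rw [h.fderiv]
    simp
  rw [key, key, hs.eq]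

end dirDeriv

/-- The mixed partial derivative `∂_x^i ∂_y^j f` of a function on the plane. -/
def mixedPartial {F : Type*} [NormedAddCommGroup F] [NormedSpace ℝ F] (f : ℝ × ℝ → F)
    (i j : ℕ) : ℝ × ℝ → F :=
  (dirDeriv (1, 0))^[i] ((dirDeriv (0, 1))^[j] f)

section mixedPartial

variable {F : Type*} [NormedAddCommGroup F] [NormedSpace ℝ F] {f : ℝ × ℝ → F}
  {U : Set (ℝ × ℝ)}

lemma ContDiffOn.mixedPartial (hf : ContDiffOn ℝ (⊤ : ℕ∞) f U) (hU : IsOpen U) (i j : ℕ) :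
    ContDiffOn ℝ (⊤ : ℕ∞) (mixedPartial f i j) U :=
  (hf.iterate_dirDeriv hU _ j).iterate_dirDeriv hU _ i

lemma dirDeriv_fst_mixedPartial (i j : ℕ) :
    dirDeriv (1, 0) (mixedPartial f i j) = mixedPartial f (i + 1) j :=
  (Function.iterate_succ_apply' _ _ _).symm

lemma dirDeriv_snd_mixedPartial (hf : ContDiffOn ℝ (⊤ : ℕ∞) f U) (hU : IsOpen U) (i j : ℕ) :
    Set.EqOn (dirDeriv (0, 1) (mixedPartial f i j)) (mixedPartial f i (j + 1)) U := by
  induction i with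
  | zero =>
    intro p _
    simp only [_root_.mixedPartial, Function.iterate_zero, id, Function.iterate_succ_apply']
  | succ i ih =>
    rw [← dirDeriv_fst_mixedPartial, ← dirDeriv_fst_mixedPartial]
    exact (dirDeriv_comm (hf.mixedPartial hU i j) hU _ _).trans (ih.dirDeriv hU _)

lemma fderiv_mixedPartial_apply (hf : ContDiffOn ℝ (⊤ : ℕ∞) f U) (hU : IsOpen U) (i j : ℕ)
    {p : ℝ × ℝ} (hp : p ∈ U) (a b : ℝ) :
    fderiv ℝ (mixedPartial f i j) p (a, b)
      = a • mixedPartial f (i + 1) j p + b • mixedPartial f i (j + 1) p := by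
  have hab : ((a, b) : ℝ × ℝ) = a • (1, 0) + b • (0, 1) := by simp
  rw [hab, map_add, map_smul, map_smul, ← dirDeriv_fst_mixedPartial,
    ← dirDeriv_snd_mixedPartial hf hU i j hp]
  rfl

lemma hasDerivAt_mixedPartial_comp (hf : ContDiffOn ℝ (⊤ : ℕ∞) f U) (hU : IsOpen U) (i j : ℕ)
    {u v : ℝ → ℝ} {u' v' t : ℝ} (ht : (u t, v t) ∈ U) (hu : HasDerivAt u u' t)
    (hv : HasDerivAt v v' t) :
    HasDerivAt (fun s => mixedPartial f i j (u s, v s))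
      (u' • mixedPartial f (i + 1) j (u t, v t) + v' • mixedPartial f i (j + 1) (u t, v t))
      t := by
  rw [← fderiv_mixedPartial_apply hf hU i j ht]
  have hd : DifferentiableAt ℝ (mixedPartial f i j) (u t, v t) :=
    ((hf.mixedPartial hU i j).contDiffAt (hU.mem_nhds ht)).differentiableAt (by simp)
  exact hd.hasFDerivAt.comp_hasDerivAt t (hu.prodMk hv)

end mixedPartial

section puncturedPlane

variable {F : Type*} [NormedAddCommGroup F] [NormedSpace ℝ F] {f : ℝ × ℝ → F}

lemma isOpen_fst_ne_zero : IsOpen {p : ℝ × ℝ | p.1 ≠ 0} :=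
  isOpen_ne.preimage continuous_fst

lemma iteratedDeriv_snd_eq_mixedPartial
    (hf : ContDiffOn ℝ (⊤ : ℕ∞) f {p : ℝ × ℝ | p.1 ≠ 0}) (j : ℕ) {x : ℝ} (hx : x ≠ 0) :
    iteratedDeriv j (fun y => f (x, y)) = fun y => mixedPartial f 0 j (x, y) := by
  induction j with
  | zero => rfl
  | succ j ih =>
    rw [iteratedDeriv_succ, ih]
    funext y
    simpa using (hasDerivAt_mixedPartial_comp hf isOpen_fst_ne_zero 0 j (t := y)
      (u := fun _ => x) (v := id) hx (hasDerivAt_const _ _) (hasDerivAt_id _)).deriv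

lemma iteratedDeriv_iteratedDeriv_eq_mixedPartial
    (hf : ContDiffOn ℝ (⊤ : ℕ∞) f {p : ℝ × ℝ | p.1 ≠ 0}) (i j : ℕ) (y : ℝ) :
    ∀ x : ℝ, x ≠ 0 → iteratedDeriv i (fun x => iteratedDeriv j (fun y => f (x, y)) y) x
      = mixedPartial f i j (x, y) := by
  induction i with
  | zero =>
    intro x hx
    rw [iteratedDeriv_zero, iteratedDeriv_snd_eq_mixedPartial hf j hx]
  | succ i ih =>
    intro x hx
    have h : iteratedDeriv i (fun x => iteratedDeriv j (fun y => f (x, y)) y)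
        =ᶠ[𝓝 x] fun x => mixedPartial f i j (x, y) := by
      filter_upwards [isOpen_ne.mem_nhds hx] with x' hx' using ih x' hx'
    rw [iteratedDeriv_succ, h.deriv_eq]
    simpa using (hasDerivAt_mixedPartial_comp hf isOpen_fst_ne_zero i j (t := x)
      (u := id) (v := fun _ => y) hx (hasDerivAt_id _) (hasDerivAt_const _ _)).deriv

/-- The function `x ↦ x^m (∂_x^i ∂_y^j f)(x, y - cx²)`. -/
def shearTerm (f : ℝ × ℝ → F) (c y : ℝ) (m : ℤ) (i j : ℕ) (x : ℝ) : F :=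
  x ^ m • mixedPartial f i j (x, y - c * x ^ 2)

lemma contDiffAt_shearTerm (hf : ContDiffOn ℝ (⊤ : ℕ∞) f {p : ℝ × ℝ | p.1 ≠ 0}) (c y : ℝ)
    (m : ℤ) (i j : ℕ) {x : ℝ} (hx : x ≠ 0) (n : ℕ) :
    ContDiffAt ℝ n (shearTerm f c y m i j) x := by
  have h1 : ContDiffAt ℝ n (fun x : ℝ => x ^ m) x := by
    cases m with
    | ofNat k => simpa using contDiffAt_id.pow k
    | negSucc k =>
      simp only [zpow_negSucc]
      exact (contDiffAt_id.pow (k + 1)).inv (pow_ne_zero _ hx)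
  have h2 : ContDiffAt ℝ n (mixedPartial f i j) (x, y - c * x ^ 2) :=
    ((hf.mixedPartial isOpen_fst_ne_zero i j).contDiffAt
      (isOpen_fst_ne_zero.mem_nhds hx)).of_le (by exact_mod_cast le_top)
  have h3 : ContDiffAt ℝ n (fun x : ℝ => (x, y - c * x ^ 2)) x := by fun_prop
  exact h1.smul (ContDiffAt.comp x h2 h3)

lemma deriv_shearTerm (hf : ContDiffOn ℝ (⊤ : ℕ∞) f {p : ℝ × ℝ | p.1 ≠ 0}) (c y : ℝ)
    (m : ℤ) (i j : ℕ) {x : ℝ} (hx : x ≠ 0) :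
    deriv (shearTerm f c y m i j) x = (m : ℝ) • shearTerm f c y (m - 1) i j x
      + shearTerm f c y m (i + 1) j x + (-2 * c) • shearTerm f c y (m + 1) i (j + 1) x := by
  have hv : HasDerivAt (fun x : ℝ => y - c * x ^ 2) (-2 * c * x) x :=
    (((hasDerivAt_pow 2 x).const_mul c).const_sub y).congr_deriv (by push_cast; ring)
  have h := (hasDerivAt_zpow m x (Or.inl hx)).smul
    (hasDerivAt_mixedPartial_comp hf isOpen_fst_ne_zero i j (t := x) (u := id) hx
      (hasDerivAt_id x) hv)
  have hd := h.deriv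
  change deriv (shearTerm f c y m i j) x = _ at hd
  rw [hd]
  simp only [shearTerm, id, zpow_add_one₀ hx]
  module

lemma iteratedDeriv_succ_shearTerm (hf : ContDiffOn ℝ (⊤ : ℕ∞) f {p : ℝ × ℝ | p.1 ≠ 0})
    (c y : ℝ) (m : ℤ) (i j n : ℕ) {x : ℝ} (hx : x ≠ 0) :
    iteratedDeriv (n + 1) (shearTerm f c y m i j) x
      = (m : ℝ) • iteratedDeriv n (shearTerm f c y (m - 1) i j) x
        + iteratedDeriv n (shearTerm f c y m (i + 1) j) x
        + (-2 * c) • iteratedDeriv n (shearTerm f c y (m + 1) i (j + 1)) x := by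
  have h : deriv (shearTerm f c y m i j) =ᶠ[𝓝 x] (m : ℝ) • shearTerm f c y (m - 1) i j
      + shearTerm f c y m (i + 1) j + (-2 * c) • shearTerm f c y (m + 1) i (j + 1) := by
    filter_upwards [isOpen_ne.mem_nhds hx] with x' hx' using deriv_shearTerm hf c y m i j hx'
  have hs := fun m i j => contDiffAt_shearTerm hf c y m i j hx n
  have hsmul : ∀ (a : ℝ) (m : ℤ) (i j : ℕ), ContDiffAt ℝ n (a • shearTerm f c y m i j) x :=
    fun a m i j => (hs m i j).const_smul a
  have hadd : ContDiffAt ℝ n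
      ((m : ℝ) • shearTerm f c y (m - 1) i j + shearTerm f c y m (i + 1) j) x :=
    (hsmul _ _ _ _).add (hs _ _ _)
  rw [iteratedDeriv_succ', h.iteratedDeriv_eq, iteratedDeriv_add hadd (hsmul _ _ _ _),
    iteratedDeriv_add (hsmul _ _ _ _) (hs _ _ _),
    iteratedDeriv_const_smul_field, iteratedDeriv_const_smul_field]

end puncturedPlane

lemma inv_sq_add_abs_shear_le (c y : ℝ) {x : ℝ} (hx : x ≠ 0) :
    (x ^ 2 + |y - c * x ^ 2|)⁻¹ ≤ (1 + |c|) * (x ^ 2 + |y|)⁻¹ := by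
  have hx2 : 0 < x ^ 2 := by positivity
  have h : |y| ≤ |y - c * x ^ 2| + |c| * x ^ 2 := by
    calc |y| = |(y - c * x ^ 2) + c * x ^ 2| := by ring_nf
      _ ≤ |y - c * x ^ 2| + |c * x ^ 2| := abs_add_le _ _
      _ = _ := by rw [abs_mul, abs_of_pos hx2]
  rw [← div_eq_mul_inv, inv_le_comm₀ (by positivity) (by positivity), inv_div,
    div_le_iff₀ (by positivity)]
  nlinarith [abs_nonneg c, abs_nonneg (y - c * x ^ 2)]

lemma exists_norm_iteratedDeriv_shearTerm_le (F : Type*) [NormedAddCommGroup F]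
    [NormedSpace ℝ F] (c : ℝ) (A : ℕ → ℕ → ℝ) (n : ℕ) :
    ∀ (m : ℤ) (i j : ℕ), ∃ C : ℝ, 0 ≤ C ∧ ∀ f : ℝ × ℝ → F,
      ContDiffOn ℝ (⊤ : ℕ∞) f {p : ℝ × ℝ | p.1 ≠ 0} →
      (∀ (i j : ℕ) (x y : ℝ), x ≠ 0 → ‖mixedPartial f i j (x, y)‖
        ≤ A i j * |x| ^ (-1 - i : ℤ) * (x ^ 2 + |y|)⁻¹ ^ (1 + j)) →
      ∀ x y : ℝ, x ≠ 0 → ‖iteratedDeriv n (shearTerm f c y m i j) x‖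
        ≤ C * |x| ^ (m - 1 - i - n : ℤ) * (x ^ 2 + |y|)⁻¹ ^ (1 + j) := by
  induction n with
  | zero =>
    intro m i j
    refine ⟨|A i j| * (1 + |c|) ^ (1 + j), by positivity, fun f _ hA x y hx => ?_⟩
    have hx' : 0 < |x| := abs_pos.mpr hx
    rw [iteratedDeriv_zero, shearTerm, norm_smul, norm_zpow, Real.norm_eq_abs]
    calc |x| ^ m * ‖mixedPartial f i j (x, y - c * x ^ 2)‖
        ≤ |x| ^ m * (|A i j| * |x| ^ (-1 - i : ℤ)
            * ((1 + |c|) * (x ^ 2 + |y|)⁻¹) ^ (1 + j)) := by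
          refine mul_le_mul_of_nonneg_left ((hA i j x _ hx).trans ?_) (by positivity)
          gcongr
          · exact le_abs_self _
          · exact inv_sq_add_abs_shear_le c y hx
      _ = |A i j| * (1 + |c|) ^ (1 + j) * |x| ^ (m - 1 - i - (0 : ℕ) : ℤ)
            * (x ^ 2 + |y|)⁻¹ ^ (1 + j) := by
          rw [show (m - 1 - i - (0 : ℕ) : ℤ) = m + (-1 - i) by push_cast; ring,
            zpow_add₀ hx'.ne', mul_pow]
          ring
  | succ n ih =>
    intro m i j
    obtain ⟨C₁, hC₁, h₁⟩ := ih (m - 1) i j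
    obtain ⟨C₂, hC₂, h₂⟩ := ih m (i + 1) j
    obtain ⟨C₃, hC₃, h₃⟩ := ih (m + 1) i (j + 1)
    refine ⟨|(m : ℝ)| * C₁ + C₂ + |-2 * c| * C₃, by positivity, fun f hf hA x y hx => ?_⟩
    have hx' : 0 < |x| := abs_pos.mpr hx
    set r := (x ^ 2 + |y|)⁻¹ with hr
    have hr0 : 0 ≤ r := by positivity
    have hxr : |x| ^ 2 * r ≤ 1 := by
      rw [hr, sq_abs, ← div_eq_mul_inv, div_le_one (by positivity)]
      linarith [abs_nonneg y]
    set e : ℤ := m - 1 - i - (n + 1 : ℕ) with he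
    have b₁ : ‖iteratedDeriv n (shearTerm f c y (m - 1) i j) x‖
        ≤ C₁ * |x| ^ e * r ^ (1 + j) := by
      refine (h₁ f hf hA x y hx).trans_eq ?_
      rw [show (m - 1 - 1 - i - n : ℤ) = e by rw [he]; push_cast; ring]
    have b₂ : ‖iteratedDeriv n (shearTerm f c y m (i + 1) j) x‖
        ≤ C₂ * |x| ^ e * r ^ (1 + j) := by
      refine (h₂ f hf hA x y hx).trans_eq ?_
      rw [show (m - 1 - (i + 1 : ℕ) - n : ℤ) = e by rw [he]; push_cast; ring]
    have b₃ : ‖iteratedDeriv n (shearTerm f c y (m + 1) i (j + 1)) x‖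
        ≤ C₃ * |x| ^ e * r ^ (1 + j) := by
      refine (h₃ f hf hA x y hx).trans ?_
      rw [show (m + 1 - 1 - i - n : ℤ) = e + 2 by rw [he]; push_cast; ring,
        zpow_add₀ hx'.ne']
      calc C₃ * (|x| ^ e * |x| ^ (2 : ℤ)) * r ^ (1 + (j + 1))
          = C₃ * |x| ^ e * r ^ (1 + j) * (|x| ^ 2 * r) := by
            rw [zpow_ofNat]
            ring
        _ ≤ C₃ * |x| ^ e * r ^ (1 + j) := mul_le_of_le_one_right (by positivity) hxr
    rw [iteratedDeriv_succ_shearTerm hf c y m i j n hx]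
    refine (norm_add₃_le).trans ?_
    rw [norm_smul, norm_smul, Real.norm_eq_abs, Real.norm_eq_abs]
    calc _ ≤ |(m : ℝ)| * (C₁ * |x| ^ e * r ^ (1 + j)) + C₂ * |x| ^ e * r ^ (1 + j)
          + |-2 * c| * (C₃ * |x| ^ e * r ^ (1 + j)) := by gcongr
      _ = _ := by ring

lemma flagWeight_rpow_eq (a b : ℕ) {x : ℝ} (y : ℝ) (hx : x ≠ 0) (C : ℝ) :
    C * |x| ^ (-1 - (a : ℝ)) * (x ^ 2 + |y|) ^ (-1 - (b : ℝ))
      = C * |x| ^ (-1 - a : ℤ) * (x ^ 2 + |y|)⁻¹ ^ (1 + b) := by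
  have hxy : 0 ≤ x ^ 2 + |y| := by positivity
  rw [← Real.rpow_intCast, inv_pow, ← Real.rpow_natCast _ (1 + b), ← Real.rpow_neg hxy]
  push_cast
  ring_nf

/-- The shear `y ↦ y - cx²` preserves the class of functions satisfying
the flag-`F₂` differential inequalities
`|∂_x^α ∂_y^β M(x,y)| ≤ C_{α,β} |x|^{-1-α} (x² + |y|)^{-1-β}` away from the `y`-axis. -/
theorem shear_preserves_flagF2_bounds (c : ℝ) (Cab : ℕ → ℕ → ℝ) :
    ∃ C' : ℕ → ℕ → ℝ, ∀ M : ℝ → ℝ → ℂ,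
      ContDiffOn ℝ (⊤ : ℕ∞) (fun p : ℝ × ℝ => M p.1 p.2) {p : ℝ × ℝ | p.1 ≠ 0} →
      (∀ (α β : ℕ) (x y : ℝ), x ≠ 0 →
        ‖iteratedDeriv α (fun x' : ℝ => iteratedDeriv β (fun y' : ℝ => M x' y') y) x‖
          ≤ Cab α β * |x| ^ (-1 - (α : ℝ)) * (x ^ 2 + |y|) ^ (-1 - (β : ℝ))) →
      ContDiffOn ℝ (⊤ : ℕ∞)
          (fun p : ℝ × ℝ => M p.1 (p.2 - c * p.1 ^ 2)) {p : ℝ × ℝ | p.1 ≠ 0} ∧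
      (∀ (α β : ℕ) (x y : ℝ), x ≠ 0 →
        ‖iteratedDeriv α
            (fun x' : ℝ => iteratedDeriv β (fun y' : ℝ => M x' (y' - c * x' ^ 2)) y) x‖
          ≤ C' α β * |x| ^ (-1 - (α : ℝ)) * (x ^ 2 + |y|) ^ (-1 - (β : ℝ))) := by
  choose C _ hC using exists_norm_iteratedDeriv_shearTerm_le ℂ c Cab
  refine ⟨fun α β => C α 0 0 β, fun M hM hb => ?_⟩
  set f : ℝ × ℝ → ℂ := fun p => M p.1 p.2
  refine ⟨?_, fun α β x y hx => ?_⟩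
  · have hs : ContDiff ℝ (⊤ : ℕ∞) (fun p : ℝ × ℝ => (p.1, p.2 - c * p.1 ^ 2)) := by fun_prop
    exact hM.comp hs.contDiffOn fun p hp => hp
  · have heq : (fun x' : ℝ => iteratedDeriv β (fun y' : ℝ => M x' (y' - c * x' ^ 2)) y)
        =ᶠ[𝓝 x] shearTerm f c y 0 0 β := by
      filter_upwards [isOpen_ne.mem_nhds hx] with x' hx'
      rw [iteratedDeriv_comp_sub_const β (M x') (c * x' ^ 2), shearTerm, zpow_zero, one_smul]
      exact congrFun (iteratedDeriv_snd_eq_mixedPartial hM β hx') _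
    rw [heq.iteratedDeriv_eq, flagWeight_rpow_eq α β y hx]
    have hA : ∀ (i j : ℕ) (x y : ℝ), x ≠ 0 → ‖mixedPartial f i j (x, y)‖
        ≤ Cab i j * |x| ^ (-1 - i : ℤ) * (x ^ 2 + |y|)⁻¹ ^ (1 + j) := by
      intro i j x y hx
      rw [← iteratedDeriv_iteratedDeriv_eq_mixedPartial hM i j y x hx,
        ← flagWeight_rpow_eq i j y hx]
      exact hb i j x y hx
    simpa using hC α 0 0 β f hM hA x y hx
end
end
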